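/- arXiv:math/0111327 — 3 statements merged into one kernel-verified Lean document; each statement's English description precedes it below -/
import Mathlib

section
/- Let G be a torsion-free group which is not free and is generated by two elements, and suppose G acts simplicially and without inversions on a simplicial tree T. Then every generating pair of G is Nielsen equivalent to a pair (g,h) such that either T_g ∩ T_h ≠ ∅, or T_g ∩ h·T_g ≠ ∅ (i.e. there are vertices x, y ∈ T_g with h·x = y). -/
/-- An elementary Nielsen move on a pair of elements of a group:
swap the pair, invert the first element, or multiply the first element by the second. -/
def NielsenMove {G : Type*} [Group G] (p q : G × G) : Prop :=
  q = (p.2, p.1) ∨ q = (p.1⁻¹, p.2) ∨ q = (p.1 * p.2, p.2)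

/-- Two pairs are Nielsen equivalent if one is obtained from the other by finitely many
elementary Nielsen moves. -/
def NielsenEquiv {G : Type*} [Group G] (p q : G × G) : Prop :=
  Relation.ReflTransGen NielsenMove p q

/-- For `g` in a group `G` acting on a tree with vertex set `V`,
`fixedTree g` is the set `T_g` of vertices fixed by some nontrivial power of `g`. -/
def fixedTree {G V : Type*} [Group G] [MulAction G V] (g : G) : Set V :=
  {x : V | ∃ z : ℤ, g ^ z ≠ 1 ∧ g ^ z • x = x}

namespace SimpleGraph

variable {V : Type*} {T : SimpleGraph V}

/-- The vertices of the graph lying strictly closer to `v` than to `u`. When `u` and `v` are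
adjacent in a tree, this is the half-tree beyond the oriented edge from `u` to `v`. -/
def halfTree (T : SimpleGraph V) (u v : V) : Set V := {x | T.dist x v < T.dist x u}

theorem mem_halfTree {u v x : V} : x ∈ T.halfTree u v ↔ T.dist x v < T.dist x u := Iff.rfl

theorem left_notMem_halfTree (T : SimpleGraph V) (u v : V) : u ∉ T.halfTree u v := by
  simp [mem_halfTree]

theorem Adj.right_mem_halfTree {u v : V} (h : T.Adj u v) : v ∈ T.halfTree u v := by
  simp [mem_halfTree, dist_eq_one_iff_adj.2 h.symm]

theorem notMem_halfTree_swap {u v x : V} (h : x ∈ T.halfTree u v) : x ∉ T.halfTree v u :=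
  fun h' => lt_asymm (mem_halfTree.1 h) (mem_halfTree.1 h')

theorem IsTree.dist_of_mem_halfTree (hT : T.IsTree) {u v x : V} (h : T.Adj u v)
    (hx : x ∈ T.halfTree u v) : T.dist x u = T.dist x v + 1 := by
  rw [mem_halfTree] at hx
  have := hT.dist_eq_dist_add_one_of_adj x h
  omega

theorem IsTree.dist_of_notMem_halfTree (hT : T.IsTree) {u v x : V} (h : T.Adj u v)
    (hx : x ∉ T.halfTree u v) : T.dist x v = T.dist x u + 1 := by
  rw [mem_halfTree] at hx
  have := hT.dist_eq_dist_add_one_of_adj x h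
  omega

theorem IsTree.mem_halfTree_swap (hT : T.IsTree) {u v x : V} (h : T.Adj u v)
    (hx : x ∉ T.halfTree u v) : x ∈ T.halfTree v u := by
  rw [mem_halfTree, hT.dist_of_notMem_halfTree h hx]
  omega

/-- A geodesic leaving a half-tree passes through its bounding edge. -/
theorem IsTree.dist_crossing (hT : T.IsTree) {u v x y : V} (h : T.Adj u v)
    (hx : x ∈ T.halfTree u v) (hy : y ∉ T.halfTree u v) :
    T.dist x y = T.dist x v + 1 + T.dist u y := by
  obtain ⟨p, -, hpl⟩ := hT.connected.exists_path_of_dist x v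
  obtain ⟨q, -, hql⟩ := hT.connected.exists_path_of_dist u y
  have h1 : (p.concat h.symm).IsPath := Walk.isPath_of_length_eq_dist _ (by
    rw [Walk.length_concat, hpl, hT.dist_of_mem_halfTree h hx])
  have h2 : (Walk.cons h.symm q).IsPath := Walk.isPath_of_length_eq_dist _ (by
    have := hT.dist_of_notMem_halfTree h hy
    rw [Walk.length_cons, hql, dist_comm, dist_comm (u := v), this])
  have h3 : (p.append (Walk.cons h.symm q)).IsPath := by
    rw [hT.isAcyclic.isPath_iff_isChain] at h1 h2 ⊢
    rw [Walk.edges_concat, List.concat_eq_append] at h1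
    rw [Walk.edges_cons] at h2
    rw [Walk.edges_append, Walk.edges_cons, List.isChain_split]
    exact ⟨h1, h2⟩
  obtain ⟨r, hr, hrl⟩ := hT.connected.exists_path_of_dist x y
  rw [← hrl, (hT.existsUnique_path x y).unique hr h3, Walk.length_append, Walk.length_cons, hpl,
    hql]
  omega

theorem IsTree.eq_of_adj_crossing (hT : T.IsTree) {u v x y : V} (h : T.Adj u v)
    (hxy : T.Adj x y) (hx : x ∈ T.halfTree u v) (hy : y ∉ T.halfTree u v) : x = v ∧ y = u := by
  have h1 := hT.dist_crossing h hx hy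
  rw [dist_eq_one_iff_adj.2 hxy] at h1
  have h2 : T.dist x v = 0 := by omega
  have h3 : T.dist u y = 0 := by omega
  exact ⟨hT.connected.dist_eq_zero_iff.1 h2, (hT.connected.dist_eq_zero_iff.1 h3).symm⟩

/-- Half-trees bounded by distinct edges that point away from each other are disjoint. -/
theorem IsTree.notMem_halfTree (hT : T.IsTree) {u v u' v' x : V} (h : T.Adj u v)
    (h' : T.Adj u' v') (hu' : u' ∉ T.halfTree u v) (hu : u ∉ T.halfTree u' v')
    (hne : ¬(u = u' ∧ v = v')) (hx : x ∈ T.halfTree u v) : x ∉ T.halfTree u' v' := by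
  intro hx'
  have h1 := hT.dist_crossing h hx hu'
  have h2 := hT.dist_crossing h' hx' hu
  have h3 := hT.dist_of_mem_halfTree h hx
  have h4 := hT.dist_of_mem_halfTree h' hx'
  have h5 : T.dist u u' = 0 := by
    rw [dist_comm (u := u')] at h2
    omega
  obtain rfl := hT.connected.dist_eq_zero_iff.1 h5
  refine hne ⟨rfl, ?_⟩
  obtain ⟨p, hp, hpl⟩ := hT.connected.exists_path_of_dist x v
  obtain ⟨q, hq, hql⟩ := hT.connected.exists_path_of_dist x v'
  have hp' : (p.concat h.symm).IsPath := Walk.isPath_of_length_eq_dist _ (by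
    rw [Walk.length_concat, hpl, h3])
  have hq' : (q.concat h'.symm).IsPath := Walk.isPath_of_length_eq_dist _ (by
    rw [Walk.length_concat, hql, h4])
  have h6 := congrArg Walk.penultimate ((hT.existsUnique_path x u).unique hp' hq')
  simpa using h6

theorem IsTree.exists_adj_mem_halfTree (hT : T.IsTree) {x y : V} (hxy : x ≠ y) :
    ∃ s, T.Adj x s ∧ y ∈ T.halfTree x s := by
  obtain ⟨p, hp⟩ := hT.connected.exists_walk_length_eq_dist x y
  cases p with
  | nil => exact absurd rfl hxy
  | cons h q =>
    refine ⟨_, h, ?_⟩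
    have := dist_le q
    rw [Walk.length_cons] at hp
    rw [mem_halfTree, dist_comm, dist_comm (v := x)]
    omega

end SimpleGraph

section PingPong

open Pointwise

/-- The ping-pong lemma for two cyclic groups. -/
theorem isFreeGroup_of_ping_pong {G V : Type*} [Group G] [MulAction G V] {g h : G}
    (hgen : Subgroup.closure {g, h} = ⊤) {X Y : Set V} (hX : X.Nonempty) (hY : Y.Nonempty)
    (hXY : Disjoint X Y) (hg : ∀ n : ℤ, n ≠ 0 → ∀ v ∈ Y, g ^ n • v ∈ X)
    (hh : ∀ n : ℤ, n ≠ 0 → ∀ v ∈ X, h ^ n • v ∈ Y) : IsFreeGroup G := by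
  let c : Bool → G := fun i => cond i g h
  let f : ∀ _ : Bool, FreeGroup Unit →* G := fun i => FreeGroup.lift fun _ => c i
  let Z : Bool → Set V := fun i => cond i X Y
  have hpow : ∀ k : FreeGroup Unit, k ≠ 1 →
      ∃ n : ℤ, n ≠ 0 ∧ ∀ i, f i k = c i ^ n := by
    intro k hk
    obtain ⟨n, rfl⟩ := FreeGroup.freeGroupUnitEquivInt.symm.surjective k
    refine ⟨n, ?_, fun i => ?_⟩
    · rintro rfl
      exact hk rfl
    · change FreeGroup.lift (fun _ => c i) (FreeGroup.of () ^ n) = _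
      simp
  have hinj : Function.Injective (Monoid.CoprodI.lift f) := by
    apply Monoid.CoprodI.lift_injective_of_ping_pong f _ Z
    · rintro (_ | _)
      exacts [hY, hX]
    · rintro (_ | _) (_ | _) hij
      exacts [absurd rfl hij, hXY.symm, hXY, absurd rfl hij]
    · rintro (_ | _) (_ | _) hij k hk <;> obtain ⟨n, hn, hk'⟩ := hpow k hk
      · exact absurd rfl hij
      · rw [hk']
        rintro _ ⟨v, hv, rfl⟩
        exact hh n hn v hv
      · rw [hk']
        rintro _ ⟨v, hv, rfl⟩
        exact hg n hn v hv
      · exact absurd rfl hij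
    · right
      refine ⟨true, ?_⟩
      rw [FreeGroup.freeGroupUnitEquivInt.cardinal_eq, Cardinal.mk_denumerable]
      exact Cardinal.natCast_le_aleph0
  have hsurj : Function.Surjective (Monoid.CoprodI.lift f) := by
    rw [← MonoidHom.range_eq_top, eq_top_iff, ← hgen, Subgroup.closure_le]
    have hmem : ∀ i, c i ∈ (Monoid.CoprodI.lift f).range := fun i =>
      ⟨Monoid.CoprodI.of (i := i) (FreeGroup.of ()), by simp [f]⟩
    rintro x (rfl | rfl)
    exacts [hmem true, hmem false]
  exact IsFreeGroup.ofMulEquiv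
    (freeGroupEquivCoprodI.trans (MulEquiv.ofBijective _ ⟨hinj, hsurj⟩))

theorem isFreeGroup_of_closure_singleton {G : Type*} [Group G]
    (htf : ∀ (g : G) (n : ℕ), 1 ≤ n → g ^ n = 1 → g = 1) {h : G}
    (hgen : Subgroup.closure {h} = ⊤) : IsFreeGroup G := by
  have hsurj : Function.Surjective (FreeGroup.lift fun _ : Unit => h) := by
    rw [← MonoidHom.range_eq_top, FreeGroup.range_lift_eq_closure]
    simpa using hgen
  by_cases h1 : h = 1
  · have : Subsingleton G := by
      rw [← Subgroup.subsingleton_iff]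
      rw [h1, Subgroup.closure_singleton_one] at hgen
      exact subsingleton_of_bot_eq_top hgen
    have : Unique G := uniqueOfSubsingleton 1
    exact IsFreeGroup.ofMulEquiv (MulEquiv.ofUnique : FreeGroup Empty ≃* G)
  · refine IsFreeGroup.ofMulEquiv (MulEquiv.ofBijective _ ⟨?_, hsurj⟩)
    rw [injective_iff_map_eq_one]
    intro k hk
    rw [← FreeGroup.freeGroupUnitEquivInt.symm_apply_apply k] at hk ⊢
    generalize FreeGroup.freeGroupUnitEquivInt k = n at hk ⊢
    change FreeGroup.lift (fun _ : Unit => h) (FreeGroup.of () ^ n) = 1 at hk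
    rw [map_zpow, FreeGroup.lift_apply_of] at hk
    obtain rfl : n = 0 := by
      by_contra hn
      refine h1 (htf h n.natAbs (by omega) ?_)
      rcases Int.natAbs_eq n with h | h <;> rw [h] at hk <;> simpa using hk
    rfl

end PingPong

section Nielsen

variable {G : Type*} [Group G]

theorem NielsenEquiv.refl (p : G × G) : NielsenEquiv p p := Relation.ReflTransGen.refl

theorem NielsenEquiv.trans {p q r : G × G} (h₁ : NielsenEquiv p q) (h₂ : NielsenEquiv q r) :
    NielsenEquiv p r := Relation.ReflTransGen.trans h₁ h₂

theorem NielsenEquiv.swap (g h : G) : NielsenEquiv (g, h) (h, g) := .single (.inl rfl)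

theorem NielsenEquiv.inv_left (g h : G) : NielsenEquiv (g, h) (g⁻¹, h) := .single (.inr (.inl rfl))

theorem NielsenEquiv.mul_left (g h : G) : NielsenEquiv (g, h) (g * h, h) :=
  .single (.inr (.inr rfl))

theorem NielsenEquiv.inv_right (g h : G) : NielsenEquiv (g, h) (g, h⁻¹) :=
  (swap g h).trans ((inv_left h g).trans (swap h⁻¹ g))

theorem NielsenEquiv.mul_right (g h : G) : NielsenEquiv (g, h) (g, h * g) :=
  (swap g h).trans ((mul_left h g).trans (swap (h * g) g))

theorem NielsenEquiv.mul_inv_right (g h : G) : NielsenEquiv (g, h) (g, h * g⁻¹) := by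
  have := (inv_left g h).trans ((mul_right g⁻¹ h).trans (inv_left g⁻¹ _))
  rwa [inv_inv] at this

theorem NielsenEquiv.mul_zpow_right (g h : G) (z : ℤ) : NielsenEquiv (g, h) (g, h * g ^ z) := by
  induction z using Int.induction_on with
  | zero => simpa using refl (g, h)
  | succ n ih =>
    rw [zpow_add_one, ← mul_assoc]
    exact ih.trans (mul_right _ _)
  | pred n ih =>
    rw [zpow_sub_one, ← mul_assoc]
    exact ih.trans (mul_inv_right _ _)

theorem NielsenEquiv.closure_eq_top {p q : G × G} (h : NielsenEquiv p q)
    (hp : Subgroup.closure {p.1, p.2} = ⊤) : Subgroup.closure {q.1, q.2} = ⊤ := by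
  induction h with
  | refl => exact hp
  | @tail b c _ hbc ih =>
    rw [eq_top_iff, ← ih, Subgroup.closure_le]
    have h₁ : c.1 ∈ Subgroup.closure {c.1, c.2} := Subgroup.subset_closure (by simp)
    have h₂ : c.2 ∈ Subgroup.closure {c.1, c.2} := Subgroup.subset_closure (by simp)
    generalize Subgroup.closure {c.1, c.2} = K at h₁ h₂
    rcases hbc with rfl | rfl | rfl
    · rintro x (rfl | rfl)
      exacts [h₂, h₁]
    · rintro x (rfl | rfl)
      exacts [inv_mem_iff.1 h₁, h₂]
    · rintro x (rfl | rfl)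
      exacts [(K.mul_mem_cancel_right h₂).1 h₁, h₂]

end Nielsen

section TreeAction

open SimpleGraph

variable {G V : Type*} [Group G] {T : SimpleGraph V} [MulAction G V]

theorem SimpleGraph.dist_smul_smul (hT : T.IsTree)
    (hsimp : ∀ (g : G) (u v : V), T.Adj u v → T.Adj (g • u) (g • v)) (g : G) (x y : V) :
    T.dist (g • x) (g • y) = T.dist x y := by
  have hle : ∀ (k : G) (u v : V), T.dist (k • u) (k • v) ≤ T.dist u v := by
    intro k u v
    obtain ⟨p, hp⟩ := hT.connected.exists_walk_length_eq_dist u v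
    let φ : T →g T := ⟨fun w => k • w, hsimp k _ _⟩
    rw [← hp, ← Walk.length_map φ p]
    exact dist_le _
  refine le_antisymm (hle g x y) ?_
  simpa using hle g⁻¹ (g • x) (g • y)

theorem SimpleGraph.smul_mem_halfTree (hT : T.IsTree)
    (hsimp : ∀ (g : G) (u v : V), T.Adj u v → T.Adj (g • u) (g • v)) (g : G) {u v x : V} :
    g • x ∈ T.halfTree (g • u) (g • v) ↔ x ∈ T.halfTree u v := by
  simp only [mem_halfTree, dist_smul_smul hT hsimp]

theorem SimpleGraph.mem_halfTree_smul (hT : T.IsTree)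
    (hsimp : ∀ (g : G) (u v : V), T.Adj u v → T.Adj (g • u) (g • v)) (g : G) {u v x : V} :
    x ∈ T.halfTree (g • u) (g • v) ↔ g⁻¹ • x ∈ T.halfTree u v := by
  rw [← smul_mem_halfTree hT hsimp g (x := g⁻¹ • x), smul_inv_smul]

/-- If a half-tree and its translate by `g` are disjoint, then no power of `g` moves it inside
itself. -/
theorem SimpleGraph.zpow_smul_notMem_halfTree (hT : T.IsTree)
    (hsimp : ∀ (g : G) (u v : V), T.Adj u v → T.Adj (g • u) (g • v)) {g : G} {x s : V}
    (hxs : T.Adj x s) (hs : s ∉ T.halfTree (g • s) (g • x))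
    (hdisj : ∀ v ∈ T.halfTree s x, v ∉ T.halfTree (g • s) (g • x)) (n : ℤ) :
    g ^ n • s ∉ T.halfTree s x := by
  intro hn
  have h1 : g • g ^ n • s ∈ T.halfTree (g • s) (g • x) := (smul_mem_halfTree hT hsimp g).2 hn
  have h2 : g • g ^ n • s ∉ T.halfTree s x := fun h => hdisj _ h h1
  have h3 := hT.dist_crossing hxs.symm hn h2
  have h4 := hT.dist_crossing (hsimp g _ _ hxs.symm) h1 hs
  have h5 : T.dist (g ^ n • s) (g • g ^ n • s) = T.dist s (g • s) := by
    rw [← mul_smul, (Commute.self_zpow g n).eq, mul_smul, dist_smul_smul hT hsimp]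
  rw [dist_comm, dist_comm (u := g • s)] at h4
  omega

/-- The union of the half-tree beyond the edge from `x` to `s` and the half-tree beyond the edge
from `g • s` to `g • x`. -/
def SimpleGraph.pingSet (T : SimpleGraph V) (g : G) (x s : V) : Set V :=
  T.halfTree x s ∪ T.halfTree (g • s) (g • x)

/-- If no nontrivial power of `g` fixes `x` and the geodesic from `x` to `g⁻¹ • x` starts with the
edge from `x` to `s`, then nontrivial powers of `g` move the complement of `T.pingSet g x s` into
`T.pingSet g x s`. -/
theorem SimpleGraph.zpow_smul_mem_pingSet (hT : T.IsTree)
    (hsimp : ∀ (g : G) (u v : V), T.Adj u v → T.Adj (g • u) (g • v))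
    (hninv : ∀ (g : G) (u v : V), T.Adj u v → ¬(g • u = v ∧ g • v = u)) {g : G} {x s : V}
    (hxs : T.Adj x s) (hgx : g⁻¹ • x ∈ T.halfTree x s) (hfix : ∀ n : ℤ, n ≠ 0 → g ^ n • x ≠ x)
    {n : ℤ} (hn : n ≠ 0) {v : V} (hv : v ∉ T.pingSet g x s) : g ^ n • v ∈ T.pingSet g x s := by
  have hx : x ∉ T.halfTree (g • s) (g • x) :=
    notMem_halfTree_swap ((mem_halfTree_smul hT hsimp g).2 hgx)
  by_cases hgs : g • s ∈ T.halfTree x s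
  · have hs : s ∉ T.halfTree (g • s) (g • x) := by
      intro hs
      obtain ⟨h1, h2⟩ := hT.eq_of_adj_crossing (hsimp g _ _ hxs.symm) hxs.symm hs hx
      exact hninv g x s hxs ⟨h1.symm, h2.symm⟩
    have hdisj : ∀ w ∈ T.halfTree s x, w ∉ T.halfTree (g • s) (g • x) := fun w hw =>
      hT.notMem_halfTree hxs.symm (hsimp g _ _ hxs.symm) (notMem_halfTree_swap hgs) hs
        (fun h => hfix 1 one_ne_zero (by rw [zpow_one]; exact h.2.symm)) hw
    have key := zpow_smul_notMem_halfTree hT hsimp hxs hs hdisj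
    have hvx : v ∈ T.halfTree s x := hT.mem_halfTree_swap hxs fun h => hv (Or.inl h)
    refine Or.inl (hT.mem_halfTree_swap hxs.symm ?_)
    refine hT.notMem_halfTree (hsimp (g ^ n) _ _ hxs.symm) hxs.symm ?_ (key n)
      (fun h => hfix n hn h.2) ((smul_mem_halfTree hT hsimp (g ^ n)).2 hvx)
    rw [mem_halfTree_smul hT hsimp, ← zpow_neg]
    exact key (-n)
  · have hdisj : ∀ w ∈ T.halfTree x s, w ∉ T.halfTree (g • s) (g • x) := fun w hw =>
      hT.notMem_halfTree hxs (hsimp g _ _ hxs.symm) hgs hx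
        (fun h => hninv g x s hxs ⟨h.2.symm, h.1.symm⟩) hw
    have hstep : ∀ w, w ∉ T.halfTree x s → g • w ∈ T.halfTree (g • s) (g • x) := fun w hw =>
      (smul_mem_halfTree hT hsimp g).2 (hT.mem_halfTree_swap hxs hw)
    have hpos : ∀ m : ℕ, ∀ w, w ∉ T.halfTree x s →
        g ^ (m + 1) • w ∈ T.halfTree (g • s) (g • x) := by
      intro m
      induction m with
      | zero => intro w hw; rw [zero_add, pow_one]; exact hstep w hw
      | succ m ih =>
        intro w hw
        rw [pow_succ', mul_smul]
        exact hstep _ fun h => hdisj _ h (ih w hw)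
    have hneg : ∀ m : ℕ, ∀ w, w ∉ T.halfTree (g • s) (g • x) →
        (g⁻¹) ^ (m + 1) • w ∈ T.halfTree x s := by
      intro m w hw
      by_contra h
      apply hw
      have := hpos m _ h
      rwa [inv_pow, smul_inv_smul] at this
    obtain ⟨m, rfl | rfl⟩ := n.eq_nat_or_neg
    · obtain ⟨m, rfl⟩ := Nat.exists_eq_succ_of_ne_zero (n := m) (by omega)
      rw [zpow_natCast]
      exact Or.inr (hpos m v fun h => hv (Or.inl h))
    · obtain ⟨m, rfl⟩ := Nat.exists_eq_succ_of_ne_zero (n := m) (by omega)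
      rw [zpow_neg, zpow_natCast, ← inv_pow]
      exact Or.inl (hneg m v fun h => hv (Or.inr h))

theorem zpow_ne_one_of_ne_one (htf : ∀ (g : G) (n : ℕ), 1 ≤ n → g ^ n = 1 → g = 1) {g : G}
    (hg : g ≠ 1) {n : ℤ} (hn : n ≠ 0) : g ^ n ≠ 1 := by
  intro h
  refine hg (htf g n.natAbs (by omega) ?_)
  rcases Int.natAbs_eq n with h' | h' <;> rw [h'] at h <;> simpa using h

theorem zpow_smul_mem_fixedTree {g : G} {t : V} (ht : t ∈ fixedTree (V := V) g) (j : ℤ) :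
    g ^ j • t ∈ fixedTree (V := V) g := by
  obtain ⟨z, hz, hzt⟩ := ht
  refine ⟨z, hz, ?_⟩
  rw [← mul_smul, ← zpow_add, add_comm, zpow_add, mul_smul, hzt]

/-- The set `fixedTree g` is convex: it contains the first vertex on the geodesic between any two
of its points. -/
theorem mem_fixedTree_of_mem_halfTree (hT : T.IsTree)
    (hsimp : ∀ (g : G) (u v : V), T.Adj u v → T.Adj (g • u) (g • v)) {g : G}
    (hg : ∀ n : ℤ, n ≠ 0 → g ^ n ≠ 1) {p r t : V} (hp : p ∈ fixedTree (V := V) g)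
    (ht : t ∈ fixedTree (V := V) g) (hpr : T.Adj p r) (htr : t ∈ T.halfTree p r) :
    r ∈ fixedTree (V := V) g := by
  obtain ⟨z, hz, hzp⟩ := hp
  obtain ⟨w, hw, hwt⟩ := ht
  have hz0 : z ≠ 0 := by rintro rfl; simp at hz
  have hw0 : w ≠ 0 := by rintro rfl; simp at hw
  have hkp : g ^ (z * w) • p = p := by
    rw [zpow_mul]
    exact MulAction.mem_stabilizer_iff.1 (zpow_mem (MulAction.mem_stabilizer_iff.2 hzp) w)
  have hkt : g ^ (z * w) • t = t := by
    rw [mul_comm, zpow_mul]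
    exact MulAction.mem_stabilizer_iff.1 (zpow_mem (MulAction.mem_stabilizer_iff.2 hwt) z)
  refine ⟨z * w, hg _ (mul_ne_zero hz0 hw0), ?_⟩
  by_contra hne
  have h1 := hsimp (g ^ (z * w)) _ _ hpr
  have h2 := (smul_mem_halfTree hT hsimp (g ^ (z * w))).2 htr
  rw [hkp] at h1 h2
  rw [hkt] at h2
  exact hT.notMem_halfTree hpr h1 (left_notMem_halfTree T _ _) (left_notMem_halfTree T _ _)
    (fun h => hne h.2.symm) htr h2

/-- Two edges leaving `fixedTree g` whose half-trees are related by a power of `g` are themselves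
related by that power of `g`. -/
theorem zpow_smul_eq_of_mem_halfTree (hT : T.IsTree)
    (hsimp : ∀ (g : G) (u v : V), T.Adj u v → T.Adj (g • u) (g • v)) {g : G} {u w u' w' v : V}
    (hu : u ∈ fixedTree (V := V) g) (hu' : u' ∈ fixedTree (V := V) g) (h : T.Adj u w)
    (h' : T.Adj u' w') (hd : ∀ t ∈ fixedTree (V := V) g, t ∉ T.halfTree u w)
    (hd' : ∀ t ∈ fixedTree (V := V) g, t ∉ T.halfTree u' w') (z : ℤ) (hv : v ∈ T.halfTree u w)
    (hzv : g ^ z • v ∈ T.halfTree u' w') : g ^ z • u = u' ∧ g ^ z • w = w' := by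
  by_contra hne
  refine hT.notMem_halfTree (hsimp (g ^ z) _ _ h) h' ?_ (hd' _ (zpow_smul_mem_fixedTree hu z)) hne
    ((smul_mem_halfTree hT hsimp (g ^ z)).2 hv) hzv
  rw [mem_halfTree_smul hT hsimp, ← zpow_neg]
  exact hd _ (zpow_smul_mem_fixedTree hu' (-z))

/-- Ping-pong for an elliptic element `g` and an element `h` moving `fixedTree g` off itself, where
the geodesic from `p` to `h • q` starts with the edge from `p` to `p₁` and ends with the edge from
`h • q₁` to `h • q`. -/
theorem isFreeGroup_of_edges_leaving_fixedTree (hT : T.IsTree)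
    (hsimp : ∀ (g : G) (u v : V), T.Adj u v → T.Adj (g • u) (g • v))
    (hninv : ∀ (g : G) (u v : V), T.Adj u v → ¬(g • u = v ∧ g • v = u)) {g h : G}
    (hgen : Subgroup.closure {g, h} = ⊤) (hg : ∀ n : ℤ, n ≠ 0 → g ^ n ≠ 1)
    (hh : ∀ n : ℤ, n ≠ 0 → h ^ n ≠ 1) {p q p₁ q₁ : V} (hp : p ∈ fixedTree (V := V) g)
    (hq : q ∈ fixedTree (V := V) g) (hpp : T.Adj p p₁) (hqq : T.Adj q q₁)
    (hpd : ∀ t ∈ fixedTree (V := V) g, t ∉ T.halfTree p p₁)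
    (hqd : ∀ t ∈ fixedTree (V := V) g, t ∉ T.halfTree q q₁)
    (hhq : h • q ∈ T.halfTree p p₁) (hph : p ∈ T.halfTree (h • q) (h • q₁))
    (horbit : (p = q ∧ p₁ = q₁) ∨ ∀ z : ℤ, ¬(g ^ z • p = q ∧ g ^ z • p₁ = q₁))
    (hno : ¬(fixedTree (V := V) g ∩ fixedTree h).Nonempty) : IsFreeGroup G := by
  have hhqq := hsimp h _ _ hqq
  have hsub : ∀ v ∈ T.halfTree (h • q₁) (h • q), v ∈ T.halfTree p p₁ := by
    intro v hv
    have hp' := notMem_halfTree_swap hph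
    have hhq' := notMem_halfTree_swap hhq
    by_cases h1 : p₁ ∈ T.halfTree (h • q₁) (h • q)
    · obtain ⟨h2, h3⟩ := hT.eq_of_adj_crossing hhqq.symm hpp.symm h1 hp'
      rwa [h2, h3]
    by_cases h2 : h • q₁ ∈ T.halfTree p₁ p
    · obtain ⟨h3, h4⟩ := hT.eq_of_adj_crossing hpp.symm hhqq.symm h2 hhq'
      rwa [← h3, ← h4]
    refine hT.mem_halfTree_swap hpp.symm
      (hT.notMem_halfTree hhqq.symm hpp.symm h1 h2 (fun h3 => ?_) hv)
    rw [h3.2] at hhq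
    exact left_notMem_halfTree T _ _ hhq
  have hX : ∀ v ∈ T.pingSet h q q₁, v ∈ T.halfTree p p₁ ∨ v ∈ T.halfTree q q₁ := by
    rintro v (hv | hv)
    exacts [Or.inr hv, Or.inl (hsub v hv)]
  have hfix : ∀ t ∈ fixedTree (V := V) g, t ∉ T.pingSet h q q₁ := fun t ht hX' =>
    (hX t hX').elim (hpd t ht) (hqd t ht)
  have hnotfix : ∀ z : ℤ, z ≠ 0 → ∀ w, (∀ t ∈ fixedTree (V := V) g, t ≠ w) → g ^ z • w ≠ w :=
    fun z hz w hw hzw => hw w ⟨z, hg z hz, hzw⟩ rfl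
  have hp₁ : ∀ t ∈ fixedTree (V := V) g, t ≠ p₁ := by
    rintro t ht rfl
    exact hpd _ ht hpp.right_mem_halfTree
  have hq₁ : ∀ t ∈ fixedTree (V := V) g, t ≠ q₁ := by
    rintro t ht rfl
    exact hqd _ ht hqq.right_mem_halfTree
  refine isFreeGroup_of_ping_pong hgen (X := (T.pingSet h q q₁)ᶜ) (Y := T.pingSet h q q₁)
    ⟨q, hfix q hq⟩ ⟨q₁, Or.inl hqq.right_mem_halfTree⟩ disjoint_compl_left ?_ ?_
  · intro z hz v hv hzv
    rcases hX v hv with h1 | h1 <;> rcases hX _ hzv with h2 | h2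
    · exact hnotfix z hz p₁ hp₁
        (zpow_smul_eq_of_mem_halfTree hT hsimp hp hp hpp hpp hpd hpd z h1 h2).2
    · have h3 := zpow_smul_eq_of_mem_halfTree hT hsimp hp hq hpp hqq hpd hqd z h1 h2
      rcases horbit with ⟨-, rfl⟩ | h4
      exacts [hnotfix z hz p₁ hp₁ h3.2, h4 z h3]
    · have h3 := zpow_smul_eq_of_mem_halfTree hT hsimp hq hp hqq hpp hqd hpd z h1 h2
      rcases horbit with ⟨-, rfl⟩ | h4
      · exact hnotfix z hz p₁ hp₁ h3.2
      · refine h4 (-z) ⟨?_, ?_⟩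
        · rw [zpow_neg, inv_smul_eq_iff, h3.1]
        · rw [zpow_neg, inv_smul_eq_iff, h3.2]
    · exact hnotfix z hz q₁ hq₁
        (zpow_smul_eq_of_mem_halfTree hT hsimp hq hq hqq hqq hqd hqd z h1 h2).2
  · intro z hz v hv
    refine zpow_smul_mem_pingSet hT hsimp hninv hqq ?_ (fun n hn hnq => ?_) hz hv
    · rw [← mem_halfTree_smul hT hsimp]
      exact hT.mem_halfTree_swap hhqq.symm fun h1 => hpd q hq (hsub q h1)
    · exact hno ⟨q, hq, n, hh n hn, hnq⟩

/-- The theorem in the case where `g` is elliptic. -/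
theorem isFreeGroup_of_fixedTree_nonempty (hT : T.IsTree)
    (hsimp : ∀ (g : G) (u v : V), T.Adj u v → T.Adj (g • u) (g • v))
    (hninv : ∀ (g : G) (u v : V), T.Adj u v → ¬(g • u = v ∧ g • v = u)) {g h : G}
    (hpow : ∀ g' h' : G, NielsenEquiv (g, h) (g', h') → ∀ n : ℤ, n ≠ 0 → g' ^ n ≠ 1)
    (hgen : Subgroup.closure {g, h} = ⊤) (hne : (fixedTree (V := V) g).Nonempty)
    (hno : ∀ g' h' : G, NielsenEquiv (g, h) (g', h') →
      ¬(fixedTree (V := V) g' ∩ fixedTree h').Nonempty)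
    (hoff : ∀ x ∈ fixedTree (V := V) g, ∀ y ∈ fixedTree (V := V) g, h • x ≠ y) :
    IsFreeGroup G := by
  obtain ⟨t₀, ht₀⟩ := hne
  have hg := hpow g h (.refl _)
  obtain ⟨⟨p, q⟩, ⟨hp, hq⟩, hmin⟩ := (measure fun r : V × V => T.dist r.1 (h • r.2)).wf.has_min
    {r | r.1 ∈ fixedTree (V := V) g ∧ r.2 ∈ fixedTree (V := V) g} ⟨(t₀, t₀), ht₀, ht₀⟩
  have hmin' : ∀ p' ∈ fixedTree (V := V) g, ∀ q' ∈ fixedTree (V := V) g,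
      ¬ T.dist p' (h • q') < T.dist p (h • q) := fun p' hp' q' hq' => hmin (p', q') ⟨hp', hq'⟩
  simp only at hp hq
  obtain ⟨p₁, hpp, hhq⟩ := hT.exists_adj_mem_halfTree (hoff q hq p hp).symm
  obtain ⟨s, hs, hps⟩ := hT.exists_adj_mem_halfTree (hoff q hq p hp)
  obtain ⟨q₁, rfl⟩ : ∃ q₁, s = h • q₁ := ⟨h⁻¹ • s, (smul_inv_smul h s).symm⟩
  have hqq : T.Adj q q₁ := by simpa using hsimp h⁻¹ _ _ hs
  have hpd : ∀ t ∈ fixedTree (V := V) g, t ∉ T.halfTree p p₁ := by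
    intro t ht h1
    refine hmin' _ (mem_fixedTree_of_mem_halfTree hT hsimp hg hp ht hpp h1) q hq ?_
    rw [dist_comm, dist_comm (u := p)]
    exact hhq
  have hqd : ∀ t ∈ fixedTree (V := V) g, t ∉ T.halfTree q q₁ := fun t ht h1 =>
    hmin' p hp _ (mem_fixedTree_of_mem_halfTree hT hsimp hg hq ht hqq h1) hps
  have hpow' : ∀ h' : G, NielsenEquiv (g, h) (g, h') → ∀ n : ℤ, n ≠ 0 → h' ^ n ≠ 1 := fun h' hN =>
    hpow h' g (hN.trans (.swap g h'))
  by_cases horbit : ∃ z : ℤ, g ^ z • p = q ∧ g ^ z • p₁ = q₁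
  · obtain ⟨z, rfl, rfl⟩ := horbit
    have hN := NielsenEquiv.mul_zpow_right g h z
    rw [← mul_smul] at hhq hps
    rw [← mul_smul] at hps
    exact isFreeGroup_of_edges_leaving_fixedTree hT hsimp hninv (hN.closure_eq_top hgen) hg
      (hpow' _ hN) hp hp hpp hpp hpd hpd hhq hps (Or.inl ⟨rfl, rfl⟩) (hno _ _ hN)
  · exact isFreeGroup_of_edges_leaving_fixedTree hT hsimp hninv hgen hg (hpow' _ (.refl _)) hp hq
      hpp hqq hpd hqd hhq hps (Or.inr fun z hz => horbit ⟨z, hz⟩) (hno _ _ (.refl _))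

/-- The point `x` and the pair `(g, h)` minimize, lexicographically, the total displacement of `x`
and the distance between its two images, among all points and all Nielsen equivalent pairs. -/
def IsNielsenMinimal (T : SimpleGraph V) (x : V) (g h : G) : Prop :=
  ∀ (y : V) (g' h' : G), NielsenEquiv (g, h) (g', h') →
    T.dist x (g • x) + T.dist x (h • x) < T.dist y (g' • y) + T.dist y (h' • y) ∨
      T.dist x (g • x) + T.dist x (h • x) = T.dist y (g' • y) + T.dist y (h' • y) ∧
        T.dist (g • x) (h • x) ≤ T.dist (g' • y) (h' • y)

theorem IsNielsenMinimal.swap {x : V} {g h : G} (hm : IsNielsenMinimal T x g h) :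
    IsNielsenMinimal T x h g := by
  intro y g' h' hN
  have := hm y g' h' ((NielsenEquiv.swap g h).trans hN)
  rwa [add_comm (T.dist x (h • x)), dist_comm (u := h • x)]

theorem exists_isNielsenMinimal [Nonempty V] (T : SimpleGraph V) (a b : G) :
    ∃ (x : V) (g h : G), NielsenEquiv (a, b) (g, h) ∧ IsNielsenMinimal T x g h := by
  let F : V × G × G → ℕ ×ₗ ℕ := fun r => toLex
    (T.dist r.1 (r.2.1 • r.1) + T.dist r.1 (r.2.2 • r.1), T.dist (r.2.1 • r.1) (r.2.2 • r.1))
  obtain ⟨⟨x, g, h⟩, hN, hmin⟩ := (InvImage.wf F wellFounded_lt).has_min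
    {r | NielsenEquiv (a, b) r.2} ⟨(Classical.arbitrary V, a, b), NielsenEquiv.refl _⟩
  refine ⟨x, g, h, hN, fun y g' h' hN' => ?_⟩
  have h1 : F (x, g, h) ≤ F (y, g', h') := not_lt.1 (hmin (y, g', h') (hN.trans hN'))
  exact Prod.Lex.toLex_le_toLex.1 h1

theorem dist_inv_smul_left (hT : T.IsTree)
    (hsimp : ∀ (g : G) (u v : V), T.Adj u v → T.Adj (g • u) (g • v)) (g : G) (x y : V) :
    T.dist (g⁻¹ • x) y = T.dist x (g • y) := by
  rw [← dist_smul_smul hT hsimp g, smul_inv_smul]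

theorem dist_smul_add_two (hT : T.IsTree)
    (hsimp : ∀ (g : G) (u v : V), T.Adj u v → T.Adj (g • u) (g • v))
    (hninv : ∀ (g : G) (u v : V), T.Adj u v → ¬(g • u = v ∧ g • v = u)) {g : G} {x s : V}
    (hxs : T.Adj x s) (hgx : g • x ∈ T.halfTree x s) (hxg : x ∈ T.halfTree (g • x) (g • s)) :
    T.dist s (g • s) + 2 = T.dist x (g • x) := by
  have hs : s ∈ T.halfTree (g • x) (g • s) := by
    by_contra hs
    obtain ⟨h1, h2⟩ := hT.eq_of_adj_crossing (hsimp g _ _ hxs) hxs hxg hs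
    exact hninv g x s hxs ⟨h2.symm, h1.symm⟩
  have h1 := hT.dist_of_mem_halfTree (hsimp g _ _ hxs) hs
  have h2 := hT.dist_of_mem_halfTree hxs hgx
  rw [dist_comm, dist_comm (v := s)] at h2
  omega

theorem dist_smul_self_le_of_mem (hT : T.IsTree)
    (hsimp : ∀ (g : G) (u v : V), T.Adj u v → T.Adj (g • u) (g • v)) {g : G} {x s : V}
    (hxs : T.Adj x s) (hgx : g • x ∈ T.halfTree x s) : T.dist s (g • s) ≤ T.dist x (g • x) := by
  have h1 := hT.dist_of_mem_halfTree hxs hgx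
  have h2 := hT.connected.dist_triangle (u := s) (v := g • x) (w := g • s)
  rw [dist_comm, dist_comm (v := s)] at h1
  rw [dist_smul_smul hT hsimp, dist_eq_one_iff_adj.2 hxs] at h2
  omega

theorem dist_smul_self_le_of_inv_mem (hT : T.IsTree)
    (hsimp : ∀ (g : G) (u v : V), T.Adj u v → T.Adj (g • u) (g • v)) {g : G} {x s : V}
    (hxs : T.Adj x s) (hgx : g⁻¹ • x ∈ T.halfTree x s) :
    T.dist s (g • s) ≤ T.dist x (g • x) := by
  have h1 := dist_smul_self_le_of_mem hT hsimp hxs hgx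
  rwa [dist_comm, dist_inv_smul_left hT hsimp, dist_comm (u := x), dist_inv_smul_left hT hsimp] at h1

theorem IsNielsenMinimal.dist_le (hT : T.IsTree)
    (hsimp : ∀ (g : G) (u v : V), T.Adj u v → T.Adj (g • u) (g • v)) {x : V} {g h : G}
    (hm : IsNielsenMinimal T x g h) : T.dist x (g • x) ≤ T.dist (g • x) (h • x) := by
  have hN : NielsenEquiv (g, h) (g⁻¹ * h, h) :=
    (NielsenEquiv.inv_left g h).trans (.mul_left g⁻¹ h)
  have h1 := hm x _ _ hN
  rw [mul_smul, dist_comm (u := x) (v := g⁻¹ • h • x), dist_inv_smul_left hT hsimp, dist_comm (u := h • x) (v := g • x)] at h1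
  omega

theorem IsNielsenMinimal.dist_le' (hT : T.IsTree)
    (hsimp : ∀ (g : G) (u v : V), T.Adj u v → T.Adj (g • u) (g • v)) {x : V} {g h : G}
    (hm : IsNielsenMinimal T x g h) : T.dist x (h • x) ≤ T.dist (g • x) (h • x) := by
  rw [dist_comm (u := g • x)]
  exact hm.swap.dist_le hT hsimp

theorem IsNielsenMinimal.smul_mem_halfTree (hT : T.IsTree)
    (hsimp : ∀ (g : G) (u v : V), T.Adj u v → T.Adj (g • u) (g • v)) {x s : V} {g h : G}
    (hm : IsNielsenMinimal T x g h) (hxs : T.Adj x s) (hg : g⁻¹ • x ∈ T.halfTree x s) :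
    h • x ∈ T.halfTree (g • x) (g • s) := by
  by_contra h1
  have h2 := hT.dist_crossing (hsimp g _ _ hxs) ((mem_halfTree_smul hT hsimp g).2 hg) h1
  have h3 := hm.dist_le' hT hsimp
  omega

theorem IsNielsenMinimal.inv_smul_notMem_halfTree (hT : T.IsTree)
    (hsimp : ∀ (g : G) (u v : V), T.Adj u v → T.Adj (g • u) (g • v))
    (hninv : ∀ (g : G) (u v : V), T.Adj u v → ¬(g • u = v ∧ g • v = u)) {x s : V} {g h : G}
    (hm : IsNielsenMinimal T x g h) (hxs : T.Adj x s) (hg : g⁻¹ • x ∈ T.halfTree x s) :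
    h⁻¹ • x ∉ T.halfTree x s := by
  intro hh
  have h1 : (g⁻¹ * h) • x ∈ T.halfTree x s := by
    rw [mul_smul, ← mem_halfTree_smul hT hsimp]
    exact hm.smul_mem_halfTree hT hsimp hxs hg
  have h2 : x ∈ T.halfTree ((g⁻¹ * h) • x) ((g⁻¹ * h) • s) := by
    rw [mem_halfTree_smul hT hsimp, mul_inv_rev, inv_inv, mul_smul, ← mem_halfTree_smul hT hsimp]
    exact hm.swap.smul_mem_halfTree hT hsimp hxs hh
  have h3 := dist_smul_add_two hT hsimp hninv hxs h1 h2
  have h4 : ∀ y : V, T.dist y ((g⁻¹ * h) • y) = T.dist (g • y) (h • y) := fun y => by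
    rw [mul_smul, dist_comm, dist_inv_smul_left hT hsimp, dist_comm]
  rw [h4, h4] at h3
  have h5 := hm s g h (.refl _)
  have h6 := dist_smul_self_le_of_inv_mem hT hsimp hxs hg
  have h7 := dist_smul_self_le_of_inv_mem hT hsimp hxs hh
  omega

theorem IsNielsenMinimal.smul_notMem_halfTree (hT : T.IsTree)
    (hsimp : ∀ (g : G) (u v : V), T.Adj u v → T.Adj (g • u) (g • v))
    (hninv : ∀ (g : G) (u v : V), T.Adj u v → ¬(g • u = v ∧ g • v = u)) {x s : V} {g h : G}
    (hm : IsNielsenMinimal T x g h) (hxs : T.Adj x s) (hg : g⁻¹ • x ∈ T.halfTree x s) :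
    h • x ∉ T.halfTree x s := by
  intro hh
  have h1 : g • x ∉ T.halfTree x s := by
    intro h1
    have h2 := dist_smul_add_two hT hsimp hninv hxs h1 ((mem_halfTree_smul hT hsimp g).2 hg)
    have h3 := dist_smul_self_le_of_mem hT hsimp hxs hh
    have h4 := hm s g h (.refl _)
    omega
  have h2 := hm x _ _ (.inv_left g h)
  rw [dist_comm (u := x) (v := g⁻¹ • x), dist_inv_smul_left hT hsimp] at h2
  have h3 := hT.dist_crossing hxs hh h1
  have h4 := hT.connected.dist_triangle (u := g⁻¹ • x) (v := s) (w := h • x)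
  have h5 := hT.dist_of_mem_halfTree hxs hh
  have h6 := hT.dist_of_mem_halfTree hxs hg
  rw [dist_comm, dist_comm (v := s)] at h5
  rw [dist_inv_smul_left hT hsimp] at h6
  rw [dist_comm, dist_comm (u := h • x) (v := s)] at h3
  omega

theorem IsNielsenMinimal.disjoint_halfTree (hT : T.IsTree)
    (hsimp : ∀ (g : G) (u v : V), T.Adj u v → T.Adj (g • u) (g • v))
    (hninv : ∀ (g : G) (u v : V), T.Adj u v → ¬(g • u = v ∧ g • v = u)) {x s t v : V} {g h : G}
    (hm : IsNielsenMinimal T x g h) (hhx : h • x ≠ x) (hxs : T.Adj x s) (hxt : T.Adj x t)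
    (hg : g⁻¹ • x ∈ T.halfTree x s) (hh : h⁻¹ • x ∈ T.halfTree x t) (hv : v ∈ T.halfTree x s) :
    v ∉ T.halfTree (h • t) (h • x) := by
  have h1 := hm.smul_notMem_halfTree hT hsimp hninv hxs hg
  have hxt' := hsimp h _ _ hxt.symm
  refine hT.notMem_halfTree hxs hxt' (fun h2 => ?_)
    (notMem_halfTree_swap ((mem_halfTree_smul hT hsimp h).2 hh)) (fun h2 => ?_) hv
  · exact hhx (hT.eq_of_adj_crossing hxs hxt' h2 h1).2
  · exact h1 (h2.2 ▸ hxs.right_mem_halfTree)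

theorem IsNielsenMinimal.notMem_smul_halfTree (hT : T.IsTree)
    (hsimp : ∀ (g : G) (u v : V), T.Adj u v → T.Adj (g • u) (g • v)) {x s t : V} {g h : G}
    (hm : IsNielsenMinimal T x g h) (hxs : T.Adj x s) (hxt : T.Adj x t)
    (hg : g⁻¹ • x ∈ T.halfTree x s) (hh : h⁻¹ • x ∈ T.halfTree x t) :
    g • s ∉ T.halfTree (h • t) (h • x) := by
  intro h1
  have h2 := hT.dist_crossing (hsimp h _ _ hxt.symm) h1
    (notMem_halfTree_swap ((mem_halfTree_smul hT hsimp h).2 hh))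
  have h3 := hT.dist_of_mem_halfTree (hsimp g _ _ hxs) ((mem_halfTree_smul hT hsimp g).2 hg)
  have h4 := hm.dist_le hT hsimp
  have h5 := hT.connected.dist_triangle (u := g • x) (v := g • s) (w := h • x)
  rw [dist_smul_smul hT hsimp, dist_eq_one_iff_adj.2 hxs] at h5
  have h6 := hT.dist_of_mem_halfTree (hsimp h _ _ hxt) ((mem_halfTree_smul hT hsimp h).2 hh)
  rw [dist_comm] at h2
  rw [dist_comm (u := h • t)] at h2
  omega

/-- A generating pair that is Nielsen minimal at a vertex fixed by no nontrivial power of its two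
elements generates a free group. -/
theorem IsNielsenMinimal.isFreeGroup (hT : T.IsTree)
    (hsimp : ∀ (g : G) (u v : V), T.Adj u v → T.Adj (g • u) (g • v))
    (hninv : ∀ (g : G) (u v : V), T.Adj u v → ¬(g • u = v ∧ g • v = u)) {x : V} {g h : G}
    (hm : IsNielsenMinimal T x g h) (hgen : Subgroup.closure {g, h} = ⊤)
    (hg : ∀ n : ℤ, n ≠ 0 → g ^ n • x ≠ x) (hh : ∀ n : ℤ, n ≠ 0 → h ^ n • x ≠ x) :
    IsFreeGroup G := by
  have hgx : g • x ≠ x := by simpa using hg 1 one_ne_zero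
  have hhx : h • x ≠ x := by simpa using hh 1 one_ne_zero
  obtain ⟨s, hxs, hs⟩ := hT.exists_adj_mem_halfTree
    (show x ≠ g⁻¹ • x from fun h1 => hg (-1) (by decide) (by simpa using h1.symm))
  obtain ⟨t, hxt, ht⟩ := hT.exists_adj_mem_halfTree
    (show x ≠ h⁻¹ • x from fun h1 => hh (-1) (by decide) (by simpa using h1.symm))
  have hdisj : Disjoint (T.pingSet g x s) (T.pingSet h x t) := by
    rw [Set.disjoint_left]
    rintro v (hv | hv) (hv' | hv')
    · refine hT.notMem_halfTree hxs hxt (left_notMem_halfTree T _ _) (left_notMem_halfTree T _ _)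
        (fun h1 => ?_) hv hv'
      obtain rfl := h1.2
      exact hm.inv_smul_notMem_halfTree hT hsimp hninv hxs hs ht
    · exact hm.disjoint_halfTree hT hsimp hninv hhx hxs hxt hs ht hv hv'
    · exact hm.swap.disjoint_halfTree hT hsimp hninv hgx hxt hxs ht hs hv' hv
    · refine hT.notMem_halfTree (hsimp g _ _ hxs.symm) (hsimp h _ _ hxt.symm)
        (hm.swap.notMem_smul_halfTree hT hsimp hxt hxs ht hs)
        (hm.notMem_smul_halfTree hT hsimp hxs hxt hs ht) (fun h1 => ?_) hv hv'
      have h2 := hm.dist_le hT hsimp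
      rw [h1.2, dist_self, Nat.le_zero, hT.connected.dist_eq_zero_iff] at h2
      exact hhx h2.symm
  refine isFreeGroup_of_ping_pong hgen ⟨s, Or.inl hxs.right_mem_halfTree⟩
    ⟨t, Or.inl hxt.right_mem_halfTree⟩ hdisj (fun n hn v hv => ?_) (fun n hn v hv => ?_)
  · exact zpow_smul_mem_pingSet hT hsimp hninv hxs hs hg hn (Set.disjoint_right.1 hdisj hv)
  · exact zpow_smul_mem_pingSet hT hsimp hninv hxt ht hh hn (Set.disjoint_left.1 hdisj hv)

end TreeAction

/-- **Kapovich–Weidmann.** Let `G` be a torsion-free, non-free, 2-generated group acting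
simplicially and without inversions on a simplicial tree `T`. Then every generating pair of `G`
is Nielsen equivalent to a pair `(g, h)` with `T_g ∩ T_h ≠ ∅` or `T_g ∩ h • T_g ≠ ∅`. -/
theorem generating_pair_nielsen_equiv_of_action_on_tree
    {G V : Type*} [Group G] (T : SimpleGraph V) (hT : T.IsTree)
    [MulAction G V]
    (hsimp : ∀ (g : G) (u v : V), T.Adj u v → T.Adj (g • u) (g • v))
    (hninv : ∀ (g : G) (u v : V), T.Adj u v → ¬(g • u = v ∧ g • v = u))
    (htf : ∀ (g : G) (n : ℕ), 1 ≤ n → g ^ n = 1 → g = 1)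
    (hnonfree : ¬ IsFreeGroup G)
    (h2gen : ∃ a b : G, Subgroup.closure {a, b} = ⊤)
    (a b : G) (hab : Subgroup.closure {a, b} = ⊤) :
    ∃ g h : G, NielsenEquiv (a, b) (g, h) ∧
      ((fixedTree (V := V) g ∩ fixedTree h).Nonempty ∨
        ∃ x ∈ fixedTree (V := V) g, ∃ y ∈ fixedTree (V := V) g, h • x = y) := by
  by_contra hcon
  have hno : ∀ g h : G, NielsenEquiv (a, b) (g, h) →
      ¬(fixedTree (V := V) g ∩ fixedTree h).Nonempty :=
    fun g h hN h1 => hcon ⟨g, h, hN, Or.inl h1⟩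
  have hoff : ∀ g h : G, NielsenEquiv (a, b) (g, h) →
      ∀ x ∈ fixedTree (V := V) g, ∀ y ∈ fixedTree (V := V) g, h • x ≠ y :=
    fun g h hN x hx y hy hxy => hcon ⟨g, h, hN, Or.inr ⟨x, hx, y, hy, hxy⟩⟩
  have hgen : ∀ g h : G, NielsenEquiv (a, b) (g, h) → Subgroup.closure {g, h} = ⊤ :=
    fun g h hN => hN.closure_eq_top hab
  have hpow : ∀ g h : G, NielsenEquiv (a, b) (g, h) → ∀ n : ℤ, n ≠ 0 → g ^ n ≠ 1 := by
    intro g h hN n hn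
    refine zpow_ne_one_of_ne_one htf (fun h1 => hnonfree ?_) hn
    have h2 := hgen g h hN
    rw [h1, Subgroup.closure_insert_one] at h2
    exact isFreeGroup_of_closure_singleton htf h2
  apply hnonfree
  by_cases hell : ∃ g h : G, NielsenEquiv (a, b) (g, h) ∧ (fixedTree (V := V) g).Nonempty
  · obtain ⟨g, h, hN, hne⟩ := hell
    exact isFreeGroup_of_fixedTree_nonempty hT hsimp hninv
      (fun g' h' hN' => hpow g' h' (hN.trans hN')) (hgen g h hN) hne
      (fun g' h' hN' => hno g' h' (hN.trans hN')) (hoff g h hN)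
  · have := hT.connected.nonempty
    obtain ⟨x, g, h, hN, hm⟩ := exists_isNielsenMinimal T a b
    have hfix : ∀ g h : G, NielsenEquiv (a, b) (g, h) → ∀ n : ℤ, n ≠ 0 → g ^ n • x ≠ x :=
      fun g h hN n hn h1 => hell ⟨g, h, hN, x, n, hpow g h hN n hn, h1⟩
    exact hm.isFreeGroup hT hsimp hninv (hgen g h hN) (hfix g h hN)
      (hfix h g (hN.trans (.swap g h)))
end

section
/- Let G act simplicially and without inversions on a simplicial tree T, and suppose the action is 2-acylindrical. If g ∈ G, n is an integer with g^n ≠ 1, and v is a vertex with g^n·v = v, then there exists a vertex w with g·w = w and d(v,w) ≤ 1. -/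
namespace SimpleGraph

variable {V : Type*} {T : SimpleGraph V}

/-- In an acyclic graph two distinct vertices have at most one common neighbour. -/
lemma IsAcyclic.eq_of_adj_of_adj (hT : T.IsAcyclic) {u w a b : V} (huw : u ≠ w)
    (hua : T.Adj u a) (haw : T.Adj a w) (hub : T.Adj u b) (hbw : T.Adj b w) : a = b := by
  have hp : ∀ {x} (h₁ : T.Adj u x) (h₂ : T.Adj x w),
      (Walk.cons h₁ (Walk.cons h₂ Walk.nil)).IsPath := fun h₁ h₂ => by
    simp [Walk.cons_isPath_iff, h₁.ne, h₂.ne, huw]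
  have h := congrArg (fun p : T.Path u w => p.1.support)
    ((hT.subsingleton_path u w).elim ⟨_, hp hua haw⟩ ⟨_, hp hub hbw⟩)
  simpa using h

/-- Two vertices at distance two have a common neighbour. -/
lemma exists_adj_adj_of_dist_eq_two {u w : V} (h : T.dist u w = 2) :
    ∃ c, T.Adj u c ∧ T.Adj c w := by
  obtain ⟨p, hp⟩ := exists_walk_of_dist_ne_zero (h ▸ two_ne_zero)
  rw [h] at hp
  refine ⟨p.getVert 1, ?_, ?_⟩
  · simpa using p.adj_getVert_succ (i := 0) (by lia)
  · simpa [← hp] using p.adj_getVert_succ (i := 1) (by lia)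

end SimpleGraph

/-- **2-acylindrical actions.**
If a group `G` acts simplicially and without inversions on a simplicial tree `T`,
and the action is 2-acylindrical, then every vertex `v` fixed by a nontrivial power `g ^ n`
of an element `g` is at distance at most `1` from a vertex fixed by `g`. -/
theorem fixed_vertex_near_fixed_point_of_two_acylindrical
    {G V : Type*} [Group G] (T : SimpleGraph V) (hT : T.IsTree)
    [MulAction G V]
    (hsimp : ∀ (g : G) (u v : V), T.Adj u v → T.Adj (g • u) (g • v))
    (hninv : ∀ (g : G) (u v : V), T.Adj u v → ¬(g • u = v ∧ g • v = u))
    (hacyl : ∀ g : G, g ≠ 1 → ∀ u v : V, g • u = u → g • v = v → T.dist u v ≤ 2)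
    (g : G) (n : ℤ) (hgn : g ^ n ≠ 1) (v : V) (hv : g ^ n • v = v) :
    ∃ w : V, g • w = w ∧ T.dist v w ≤ 1 := by
  have hfix : ∀ u : V, g ^ n • u = u → g ^ n • g • u = g • u := fun u hu => by
    rw [← mul_smul, (Commute.self_zpow g n).eq.symm, mul_smul, hu]
  have hle := fun u hu => hacyl _ hgn v u hv hu
  have hzero : ∀ {u}, T.dist v u = 0 → v = u := hT.connected.dist_eq_zero_iff.mp
  by_cases hgv : g • v = v
  · exact ⟨v, hgv, by simp⟩
  have h0 : T.dist v (g • v) ≠ 0 := fun h => hgv (hzero h).symm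
  have h2 := hle _ (hfix _ hv)
  obtain h | h : T.dist v (g • v) = 1 ∨ T.dist v (g • v) = 2 := by lia
  · exfalso
    have a₁ := SimpleGraph.dist_eq_one_iff_adj.mp h
    have a₂ := hsimp g _ _ a₁
    have a₃ := hsimp g _ _ a₂
    have hne : v ≠ g • g • v := fun e => hninv g _ _ a₁ ⟨rfl, e.symm⟩
    have d₂ := hT.dist_ne_of_adj v a₂
    have d₃ := hT.dist_ne_of_adj v a₃
    have l₂ := hle _ (hfix _ (hfix _ hv))
    have l₃ := hle _ (hfix _ (hfix _ (hfix _ hv)))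
    have z₂ : T.dist v (g • g • v) ≠ 0 := fun e => hne (hzero e)
    have z₃ : T.dist v (g • g • g • v) ≠ 0 := fun e => by
      have := SimpleGraph.dist_eq_one_iff_adj.mpr a₃
      rw [← hzero e, SimpleGraph.dist_comm] at this
      lia
    have a₄ : T.Adj v (g • g • g • v) := SimpleGraph.dist_eq_one_iff_adj.mp (by lia)
    exact hne (smul_left_cancel g (hT.isAcyclic.eq_of_adj_of_adj hne a₁ a₂ a₄ a₃.symm))
  · obtain ⟨c, hvc, hcg⟩ := SimpleGraph.exists_adj_adj_of_dist_eq_two h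
    have hc : g ^ n • c = c := by
      refine hT.isAcyclic.eq_of_adj_of_adj (Ne.symm hgv) ?_ ?_ hvc hcg
      · simpa only [hv] using hsimp (g ^ n) _ _ hvc
      · simpa only [hfix _ hv] using hsimp (g ^ n) _ _ hcg
    have a := hsimp g _ _ hvc
    have d := hT.dist_ne_of_adj v a
    have l := hle _ (hfix _ hc)
    have z : T.dist v (g • c) ≠ 0 := fun e => by
      have := SimpleGraph.dist_eq_one_iff_adj.mpr a
      rw [← hzero e, SimpleGraph.dist_comm] at this
      lia
    have a' : T.Adj v (g • c) := SimpleGraph.dist_eq_one_iff_adj.mp (by lia)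
    exact ⟨c, (hT.isAcyclic.eq_of_adj_of_adj (Ne.symm hgv) hvc hcg a' a.symm).symm,
      (SimpleGraph.dist_eq_one_iff_adj.mpr hvc).le⟩
end

section
/- Let C be a nontrivial group and let A and B be groups containing C as a proper subgroup (C ≠ A and C ≠ B), and let G = A *_C B be the amalgamated free product, with A, B, C identified with their images in G. Assume: (i) G is torsion-free; (ii) the splitting is 2-acylindrical, i.e. for all a ∈ A ∖ C and b ∈ B ∖ C one has C ∩ aCa⁻¹ ∩ bCb⁻¹ = {1}; (iii) G is generated by two elements and G is not a free group. Then there exists a generating pair (g,h) of G such that, possibly after exchanging the roles of A and B, g ∈ A, g^n ∈ C ∖ {1} for some n ≥ 1, and one of the following holds: (1) h ∈ B ∖ C; (2) h = ab with a ∈ A ∖ C and b ∈ B ∖ C, and a⁻¹g^m a ∈ C for some m ≥ 1; (3) h = b a b⁻¹ with b ∈ B, a ∈ A, and a^m ∈ C ∖ {1} for some m ≥ 1. -/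
/-- A two-element family of types, used to index a binary amalgamated product. -/
def BoolFam (X Y : Type u) : Bool → Type u
  | true => X
  | false => Y

instance instGroupBoolFam (X Y : Type u) [Group X] [Group Y] :
    ∀ b, Group (BoolFam X Y b)
  | true => inferInstanceAs (Group X)
  | false => inferInstanceAs (Group Y)

/-- The two inclusions of a common subgroup, as a `Bool`-indexed family of homomorphisms. -/
def boolFamHom {H : Type*} {X Y : Type u} [Group H] [Group X] [Group Y]
    (f : H →* X) (g : H →* Y) : ∀ b, H →* BoolFam X Y b
  | true => f
  | false => g

/-- The amalgamated free product `X *_H Y` of the maps `f : H →* X` and `g : H →* Y`,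
realized as an indexed pushout. -/
abbrev AmalgamatedProduct {H : Type*} {X Y : Type u} [Group H] [Group X] [Group Y]
    (f : H →* X) (g : H →* Y) : Type _ :=
  Monoid.PushoutI (boolFamHom f g)

/-- The canonical map of the left factor into the amalgamated product. -/
def AmalgamatedProduct.inl {H : Type*} {X Y : Type u} [Group H] [Group X] [Group Y]
    {f : H →* X} {g : H →* Y} : X →* AmalgamatedProduct f g :=
  Monoid.PushoutI.of (φ := boolFamHom f g) true

/-- The canonical map of the right factor into the amalgamated product. -/
def AmalgamatedProduct.inr {H : Type*} {X Y : Type u} [Group H] [Group X] [Group Y]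
    {f : H →* X} {g : H →* Y} : Y →* AmalgamatedProduct f g :=
  Monoid.PushoutI.of (φ := boolFamHom f g) false

/-- The shape of the conclusion: there is a generating pair `(g, h)` adapted to the
ordered pair of factors `(X, Y)` with amalgam `C`. -/
def AmalgamGeneratingPairConclusion {G : Type*} [Group G] (C X Y : Subgroup G) : Prop :=
  ∃ g h : G, Subgroup.closure {g, h} = ⊤ ∧ g ∈ X ∧
    (∃ n : ℕ, 1 ≤ n ∧ g ^ n ∈ C ∧ g ^ n ≠ 1) ∧
    ((h ∈ Y ∧ h ∉ C) ∨
      (∃ a b : G, a ∈ X ∧ a ∉ C ∧ b ∈ Y ∧ b ∉ C ∧ h = a * b ∧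
        ∃ m : ℕ, 1 ≤ m ∧ a⁻¹ * g ^ m * a ∈ C) ∨
      (∃ a b : G, a ∈ X ∧ b ∈ Y ∧ h = b * a * b⁻¹ ∧
        ∃ m : ℕ, 1 ≤ m ∧ a ^ m ∈ C ∧ a ^ m ≠ 1))

/-! ### Gromov products in trees -/

namespace SimpleGraph

variable {V : Type*} {T : SimpleGraph V}

/-- The Gromov product of `x` and `y` based at `w`, for the graph distance. In a tree it is the
length of the common initial segment of the geodesics from `w` to `x` and to `y`. -/
noncomputable def gromovProduct (T : SimpleGraph V) (w x y : V) : ℕ :=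
  (T.dist w x + T.dist w y - T.dist x y) / 2

theorem gromovProduct_comm (w x y : V) : T.gromovProduct w x y = T.gromovProduct w y x := by
  simp only [gromovProduct, T.dist_comm (u := x) (v := y), add_comm]

namespace IsTree

theorem even_perimeter (hT : T.IsTree) (x y z : V) :
    Even (T.dist x y + T.dist y z + T.dist x z) := by
  obtain ⟨p⟩ := hT.connected.preconnected y z
  induction p with
  | nil => simp [← two_mul]
  | @cons u v w h p ih =>
    have h₁ := hT.dist_eq_dist_add_one_of_adj x h
    have h₂ := hT.dist_eq_dist_add_one_of_adj w h
    rw [T.dist_comm (u := w) (v := u), T.dist_comm (u := w) (v := v)] at h₂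
    rw [Nat.even_iff] at ih ⊢
    omega

theorem dist_add_two_mul_gromovProduct (hT : T.IsTree) (w x y : V) :
    T.dist x y + 2 * T.gromovProduct w x y = T.dist w x + T.dist w y := by
  have h₁ := hT.even_perimeter w x y
  have h₂ := hT.connected.dist_triangle (u := x) (v := w) (w := y)
  rw [T.dist_comm (u := x) (v := w)] at h₂
  rw [Nat.even_iff] at h₁
  unfold gromovProduct
  omega

theorem gromovProduct_le_left (hT : T.IsTree) (w x y : V) :
    T.gromovProduct w x y ≤ T.dist w x := by
  have h₁ := hT.dist_add_two_mul_gromovProduct w x y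
  have h₂ := hT.connected.dist_triangle (u := w) (v := x) (w := y)
  omega

theorem gromovProduct_add (hT : T.IsTree) (w x y : V) :
    T.gromovProduct w x y + T.gromovProduct x w y = T.dist w x := by
  have h₁ := hT.dist_add_two_mul_gromovProduct w x y
  have h₂ := hT.dist_add_two_mul_gromovProduct x w y
  rw [T.dist_comm (u := x) (v := w)] at h₂
  omega

theorem exists_between (hT : T.IsTree) (x y : V) {k : ℕ} (hk : k ≤ T.dist x y) :
    ∃ z, T.dist x z = k ∧ T.dist z y + k = T.dist x y := by
  obtain ⟨p, hp⟩ := hT.connected.exists_walk_length_eq_dist x y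
  refine ⟨p.getVert k, ?_⟩
  have h₁ := T.dist_le (p.take k)
  have h₂ := T.dist_le (p.drop k)
  have h₃ := hT.connected.dist_triangle (u := x) (v := p.getVert k) (w := y)
  rw [Walk.take_length] at h₁
  rw [Walk.drop_length] at h₂
  omega

theorem eq_of_between (hT : T.IsTree) {x y z z' : V} (h : T.dist x z + T.dist z y = T.dist x y)
    (h' : T.dist x z' + T.dist z' y = T.dist x y) (hz : T.dist x z = T.dist x z') : z = z' := by
  obtain ⟨p, hp⟩ := hT.connected.exists_walk_length_eq_dist x z
  obtain ⟨q, hq⟩ := hT.connected.exists_walk_length_eq_dist z y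
  obtain ⟨p', hp'⟩ := hT.connected.exists_walk_length_eq_dist x z'
  obtain ⟨q', hq'⟩ := hT.connected.exists_walk_length_eq_dist z' y
  have h₁ : (p.append q).IsPath := Walk.isPath_of_length_eq_dist _ (by
    rw [Walk.length_append]; omega)
  have h₂ : (p'.append q').IsPath := Walk.isPath_of_length_eq_dist _ (by
    rw [Walk.length_append]; omega)
  have h₃ : p.append q = p'.append q' := (hT.existsUnique_path x y).unique h₁ h₂
  have h₄ := congrArg (fun r ↦ Walk.getVert r p.length) h₃
  simpa [Walk.getVert_append, show p.length = p'.length by omega] using h₄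

theorem exists_common_between (hT : T.IsTree) {w x y : V} {k : ℕ}
    (hk : k ≤ T.gromovProduct w x y) :
    ∃ z, T.dist w z = k ∧ T.dist z x + k = T.dist w x ∧ T.dist z y + k = T.dist w y := by
  replace hk : 2 * k + T.dist x y ≤ T.dist w x + T.dist w y := by
    have := hT.dist_add_two_mul_gromovProduct w x y
    omega
  obtain ⟨p, hp⟩ := hT.connected.exists_walk_length_eq_dist x y
  rw [← hp] at hk
  clear hp
  induction p with
  | @nil x =>
    rw [Walk.length_nil] at hk
    obtain ⟨z, hz₁, hz₂⟩ := hT.exists_between w x (k := k) (by omega)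
    exact ⟨z, hz₁, hz₂, hz₂⟩
  | @cons x v y h p ih =>
    have h₁ : T.dist x v = 1 := T.dist_eq_one_iff_adj.2 h
    have h₂ := T.dist_le p
    have h₃ := hT.connected.dist_triangle (u := w) (v := v) (w := y)
    rw [Walk.length_cons] at hk
    have key := hT.dist_eq_dist_add_one_of_adj w h
    obtain ⟨z, hz₁, hz₂, hz₃⟩ := ih (by omega)
    refine ⟨z, hz₁, ?_, hz₃⟩
    have h₄ := hT.connected.dist_triangle (u := z) (v := v) (w := x)
    rw [T.dist_comm (u := v) (v := x)] at h₄
    have h₅ := hT.connected.dist_triangle (u := w) (v := z) (w := x)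
    rcases key with key | key
    · omega
    · obtain ⟨z', hz'₁, hz'₂⟩ := hT.exists_between w x (k := k) (by omega)
      have h₆ := hT.connected.dist_triangle (u := z') (v := x) (w := v)
      have h₇ := hT.connected.dist_triangle (u := w) (v := z') (w := v)
      have : z = z' := hT.eq_of_between (x := w) (y := v) (by omega) (by omega) (by omega)
      rw [this]
      exact hz'₂

theorem eq_of_between_of_le_gromovProduct (hT : T.IsTree) {w x y z z' : V}
    (hz : T.dist w z + T.dist z x = T.dist w x) (hz' : T.dist w z' + T.dist z' y = T.dist w y)
    (h : T.dist w z = T.dist w z') (hk : T.dist w z ≤ T.gromovProduct w x y) : z = z' := by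
  obtain ⟨u, hu₁, hu₂, hu₃⟩ := hT.exists_common_between hk
  have h₁ : z = u := hT.eq_of_between (x := w) (y := x) hz (by omega) (by omega)
  have h₂ : z' = u := hT.eq_of_between (x := w) (y := y) hz' (by omega) (by omega)
  rw [h₁, h₂]

theorem le_gromovProduct_trans (hT : T.IsTree) {w x y z : V} {k : ℕ}
    (hxy : k ≤ T.gromovProduct w x y) (hyz : k ≤ T.gromovProduct w y z) :
    k ≤ T.gromovProduct w x z := by
  obtain ⟨u, hu₁, hu₂, hu₃⟩ := hT.exists_common_between hxy
  obtain ⟨v, hv₁, hv₂, hv₃⟩ := hT.exists_common_between hyz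
  have : u = v := hT.eq_of_between (x := w) (y := y) (by omega) (by omega) (by omega)
  subst this
  have h₁ := hT.dist_add_two_mul_gromovProduct w x z
  have h₂ := hT.connected.dist_triangle (u := x) (v := u) (w := z)
  rw [T.dist_comm (u := x) (v := u)] at h₂
  omega

end IsTree

end SimpleGraph

/-! ### Ping-pong for pairs of elements -/

section PingPong

open scoped Pointwise Function

variable {G : Type*} [Group G]

theorem IsFreeGroup.of_injective_lift {ι : Type*} (a : ι → G)
    (hinj : Function.Injective (FreeGroup.lift a)) (hgen : Subgroup.closure (Set.range a) = ⊤) :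
    IsFreeGroup G := by
  refine IsFreeGroup.ofMulEquiv (MulEquiv.ofBijective (FreeGroup.lift a) ⟨hinj, ?_⟩)
  rw [← MonoidHom.range_eq_top, FreeGroup.range_lift_eq_closure, hgen]

theorem range_cond_eq_pair {α : Type*} (g h : α) :
    Set.range (fun b : Bool ↦ cond b g h) = {g, h} := by
  ext x
  simp [eq_comm, or_comm]

/-- Ping-pong for two infinite cyclic groups playing on two sets. -/
theorem IsFreeGroup.of_zpow_ping_pong {α : Type*} [MulAction G α] {g h : G}
    (hgen : Subgroup.closure {g, h} = ⊤) {X Y : Set α} (hX : X.Nonempty) (hY : Y.Nonempty)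
    (hXY : Disjoint X Y) (hg : ∀ n : ℤ, n ≠ 0 → ∀ y ∈ Y, g ^ n • y ∈ X)
    (hh : ∀ n : ℤ, n ≠ 0 → ∀ x ∈ X, h ^ n • x ∈ Y) : IsFreeGroup G := by
  let a : Bool → G := fun b ↦ cond b g h
  refine IsFreeGroup.of_injective_lift a ?_ (by rw [range_cond_eq_pair, hgen])
  have hlift : FreeGroup.lift a =
      (Monoid.CoprodI.lift fun i ↦ FreeGroup.lift fun _ : Unit ↦ a i).comp
        (@freeGroupEquivCoprodI Bool).toMonoidHom := by
    ext i
    simp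
  rw [hlift, MonoidHom.coe_comp]
  refine Function.Injective.comp ?_ (MulEquiv.injective freeGroupEquivCoprodI)
  refine Monoid.CoprodI.lift_injective_of_ping_pong (fun i ↦ FreeGroup.lift fun _ : Unit ↦ a i)
    (Or.inr ⟨true, ?_⟩) (fun b ↦ cond b X Y) ?_ ?_ ?_
  · rw [FreeGroup.freeGroupUnitEquivInt.cardinal_eq, Cardinal.mk_denumerable]
    exact Cardinal.natCast_le_aleph0
  · rintro (_ | _) <;> assumption
  · rintro (_ | _) (_ | _) hij
    · exact absurd rfl hij
    · exact hXY.symm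
    · exact hXY
    · exact absurd rfl hij
  · intro i j hij
    refine FreeGroup.freeGroupUnitEquivInt.forall_congr_left.mpr fun n hn ↦ ?_
    have hn₀ : n ≠ 0 := by
      rintro rfl
      exact hn (by simp [FreeGroup.freeGroupUnitEquivInt])
    change FreeGroup.lift (fun _ ↦ a i) (FreeGroup.of () ^ n) • (cond j X Y : Set α) ⊆ cond i X Y
    simp only [map_zpow, FreeGroup.lift_apply_of]
    rintro _ ⟨x, hx, rfl⟩
    cases i <;> cases j
    · exact absurd rfl hij
    · exact hh n hn₀ x hx
    · exact hg n hn₀ x hx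
    · exact absurd rfl hij

end PingPong

/-! ### Actions on trees -/

/-- An action by automorphisms on a tree which moves every vertex by an even distance; in
particular, no edge is inverted. -/
structure IsTreeAction (G : Type*) {V : Type*} [Group G] [MulAction G V] (T : SimpleGraph V) :
    Prop where
  isTree : T.IsTree
  adj_smul (g : G) {x y : V} : T.Adj x y → T.Adj (g • x) (g • y)
  even_dist_smul (g : G) (x : V) : Even (T.dist x (g • x))

namespace IsTreeAction

variable {G V : Type*} [Group G] [MulAction G V] {T : SimpleGraph V}

theorem dist_smul_smul (hT : IsTreeAction G T) (g : G) (x y : V) :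
    T.dist (g • x) (g • y) = T.dist x y := by
  have key : ∀ (g : G) (x y : V), T.dist (g • x) (g • y) ≤ T.dist x y := by
    intro g x y
    obtain ⟨p, hp⟩ := hT.isTree.connected.exists_walk_length_eq_dist x y
    let f : T →g T := ⟨fun z ↦ g • z, hT.adj_smul g⟩
    rw [← hp, ← SimpleGraph.Walk.length_map f p]
    exact T.dist_le (p.map f)
  refine le_antisymm (key g x y) ?_
  simpa using key g⁻¹ (g • x) (g • y)

theorem gromovProduct_smul (hT : IsTreeAction G T) (g : G) (w x y : V) :
    T.gromovProduct (g • w) (g • x) (g • y) = T.gromovProduct w x y := by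
  simp only [SimpleGraph.gromovProduct, hT.dist_smul_smul]

theorem dist_inv_smul (hT : IsTreeAction G T) (g : G) (x y : V) :
    T.dist (g⁻¹ • x) y = T.dist x (g • y) := by
  rw [← hT.dist_smul_smul g, smul_inv_smul]

theorem dist_self_inv_smul (hT : IsTreeAction G T) (g : G) (x : V) :
    T.dist x (g⁻¹ • x) = T.dist x (g • x) := by
  rw [T.dist_comm, hT.dist_inv_smul]

theorem eq_of_dist_eq_zero (hT : IsTreeAction G T) {x y : V} (h : T.dist x y = 0) : x = y :=
  hT.isTree.connected.dist_eq_zero_iff.1 h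

theorem triangle (hT : IsTreeAction G T) (x y z : V) : T.dist x z ≤ T.dist x y + T.dist y z :=
  hT.isTree.connected.dist_triangle

/-- If `g` fixes `c`, it fixes the common initial segment of the geodesics from `c` to `p` and
to `g • p`. -/
theorem smul_eq_self_of_le_gromovProduct (hT : IsTreeAction G T) {g : G} {c p z : V}
    (hc : g • c = c) (hz : T.dist c z + T.dist z p = T.dist c p)
    (hk : T.dist c z ≤ T.gromovProduct c p (g • p)) : g • z = z := by
  have h₁ : T.dist c (g • z) = T.dist c z := by rw [← hT.dist_smul_smul g c z, hc]
  have h₂ : T.dist c (g • p) = T.dist c p := by rw [← hT.dist_smul_smul g c p, hc]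
  refine (hT.isTree.eq_of_between_of_le_gromovProduct hz ?_ h₁.symm hk).symm
  rw [hT.dist_smul_smul, h₁, h₂, hz]

theorem smul_eq_self_of_between (hT : IsTreeAction G T) {g : G} {x y z : V}
    (hx : g • x = x) (hy : g • y = y) (hz : T.dist x z + T.dist z y = T.dist x y) :
    g • z = z := by
  refine hT.smul_eq_self_of_le_gromovProduct hx hz ?_
  have := hT.isTree.dist_add_two_mul_gromovProduct x y (g • y)
  rw [hy, T.dist_self] at this
  rw [hy]
  omega

/-- An element moving some vertex `c` towards the same direction as its inverse, beyond half of
its displacement, is elliptic. -/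
theorem exists_fixed_of_le_two_mul_gromovProduct (hT : IsTreeAction G T) {h : G} {c : V}
    (hc : T.dist c (h • c) ≤ 2 * T.gromovProduct c (h • c) (h⁻¹ • c)) : ∃ z : V, h • z = z := by
  obtain ⟨k, hk⟩ := hT.even_dist_smul h c
  obtain ⟨z, hz₁, hz₂, hz₃⟩ :=
    hT.isTree.exists_common_between (w := c) (x := h • c) (y := h⁻¹ • c) (k := k) (by omega)
  rw [hT.dist_self_inv_smul] at hz₃
  have h₁ : T.dist z (h⁻¹ • c) = T.dist c (h • z) := by
    rw [T.dist_comm, hT.dist_inv_smul]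
  have h₂ : T.dist (h • z) (h • c) = k := by
    rw [hT.dist_smul_smul, T.dist_comm, hz₁]
  exact ⟨z, hT.isTree.eq_of_between (x := c) (y := h • c) (by omega) (by omega) (by omega)⟩

theorem lt_gromovProduct_smul (hT : IsTreeAction G T) {h : G} {c p : V} {r s : ℕ}
    (hrs : r + s < T.dist c (h • c)) (hp : T.gromovProduct c (h⁻¹ • c) p ≤ s) :
    r < T.gromovProduct c (h • c) (h • p) := by
  have h₁ := hT.isTree.gromovProduct_add c (h • c) (h • p)
  have h₂ := hT.gromovProduct_smul h c (h⁻¹ • c) p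
  rw [smul_inv_smul] at h₂
  omega

end IsTreeAction

theorem Subgroup.closure_pair_eq_top_of_mem {G : Type*} [Group G] {g h g' h' : G}
    (hgen : closure {g, h} = ⊤) (hg : g ∈ closure {g', h'}) (hh : h ∈ closure {g', h'}) :
    closure {g', h'} = ⊤ := by
  rw [eq_top_iff, ← hgen, closure_le]
  rintro x (rfl | rfl) <;> assumption

namespace IsTreeAction

variable {G V : Type*} [Group G] [MulAction G V] {T : SimpleGraph V}

theorem gromovProduct_self_right (hT : IsTreeAction G T) (w x : V) :
    T.gromovProduct w x x = T.dist w x := by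
  have := hT.isTree.dist_add_two_mul_gromovProduct w x x
  rw [T.dist_self] at this
  omega

theorem gromovProduct_base_right (hT : IsTreeAction G T) (w x : V) :
    T.gromovProduct w x w = 0 := by
  have := hT.isTree.gromovProduct_le_left w w x
  rw [T.dist_self] at this
  rw [T.gromovProduct_comm]
  omega

theorem zpow_smul_eq_self {g : G} {c : V} (hc : g • c = c) (n : ℤ) : g ^ n • c = c :=
  (MulAction.stabilizer G c).zpow_mem hc n

/-- Outside the neighbourhoods of its two directions at `c`, the nontrivial powers of `h` move
points into these neighbourhoods. -/
theorem lt_gromovProduct_zpow_smul (hT : IsTreeAction G T) {h : G} {c p : V} {r s : ℕ} {n : ℤ}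
    (hrs : r + s < T.dist c (h • c)) (hh : T.gromovProduct c (h • c) (h⁻¹ • c) ≤ min r s)
    (hn : n ≠ 0) (hp : T.gromovProduct c (h • c) p ≤ r)
    (hp' : T.gromovProduct c (h⁻¹ • c) p ≤ s) :
    r < T.gromovProduct c (h • c) (h ^ n • p) ∨ s < T.gromovProduct c (h⁻¹ • c) (h ^ n • p) := by
  have key : ∀ {h : G} {r s : ℕ}, r + s < T.dist c (h • c) →
      T.gromovProduct c (h • c) (h⁻¹ • c) ≤ min r s → T.gromovProduct c (h⁻¹ • c) p ≤ s →
      ∀ m : ℕ, r < T.gromovProduct c (h • c) (h ^ (m + 1) • p) := by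
    intro h r s hrs hh hp m
    induction m with
    | zero => simpa using hT.lt_gromovProduct_smul hrs hp
    | succ m ih =>
      rw [pow_succ' h, mul_smul]
      refine hT.lt_gromovProduct_smul hrs ?_
      by_contra! hlt
      rw [T.gromovProduct_comm] at hlt
      have := hT.isTree.le_gromovProduct_trans (k := min r s + 1) (w := c) (x := h • c)
        (y := h ^ (m + 1) • p) (z := h⁻¹ • c) (by omega) (by omega)
      omega
  obtain ⟨m, rfl | rfl⟩ := n.eq_nat_or_neg
  · obtain ⟨m, rfl⟩ := Nat.exists_eq_succ_of_ne_zero (n := m) (by omega)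
    rw [zpow_natCast]
    exact Or.inl (key hrs hh hp' m)
  · obtain ⟨m, rfl⟩ := Nat.exists_eq_succ_of_ne_zero (n := m) (by omega)
    refine Or.inr ?_
    rw [zpow_neg, zpow_natCast, ← inv_pow]
    refine key (r := s) (s := r) ?_ ?_ (by rwa [inv_inv]) m
    · rw [hT.dist_self_inv_smul]
      omega
    · rwa [inv_inv, T.gromovProduct_comm, min_comm]

/-- The powers of an elliptic element `g` fixing `c` have a largest overlap along `[c, p]`. -/
theorem exists_max_gromovProduct_zpow (hT : IsTreeAction G T) {g : G} {c : V} (p : V) :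
    ∃ k ≤ T.dist c p, (∀ n : ℤ, n ≠ 0 → T.gromovProduct c p (g ^ n • p) ≤ k) ∧
      ∃ n : ℤ, n ≠ 0 ∧ k ≤ T.gromovProduct c p (g ^ n • p) := by
  classical
  let P : ℕ → Prop := fun k ↦ ∃ n : ℤ, n ≠ 0 ∧ k ≤ T.gromovProduct c p (g ^ n • p)
  have h₀ : P 0 := ⟨1, one_ne_zero, Nat.zero_le _⟩
  refine ⟨Nat.findGreatest P (T.dist c p), Nat.findGreatest_le _, fun n hn ↦ ?_,
    Nat.findGreatest_spec (P := P) (Nat.zero_le _) h₀⟩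
  exact Nat.le_findGreatest (hT.isTree.gromovProduct_le_left _ _ _) ⟨n, hn, le_rfl⟩

/-- Two elliptic elements no nontrivial powers of which share a fixed point generate a free
group. -/
theorem isFreeGroup_of_elliptic_elliptic (hT : IsTreeAction G T) {g h : G} {c c' : V}
    (hgen : Subgroup.closure {g, h} = ⊤) (hg : g • c = c) (hh : h • c' = c')
    (hdisj : ∀ (p : V) (n m : ℤ), n ≠ 0 → m ≠ 0 → g ^ n • p = p → h ^ m • p ≠ p) :
    IsFreeGroup G := by
  obtain ⟨k, hk, hkmax, n₀, hn₀, hkn⟩ := hT.exists_max_gromovProduct_zpow (g := g) (c := c) c'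
  obtain ⟨l, -, hlmax, m₀, hm₀, hlm⟩ := hT.exists_max_gromovProduct_zpow (g := h) (c := c') c
  have hkl : k + l < T.dist c c' := by
    by_contra! hle
    obtain ⟨y, hy₁, hy₂⟩ := hT.isTree.exists_between c c' hk
    refine hdisj y n₀ m₀ hn₀ hm₀ ?_ ?_
    · exact hT.smul_eq_self_of_le_gromovProduct (zpow_smul_eq_self hg _) (p := c') (by omega)
        (by omega)
    · rw [T.dist_comm] at hy₁ hy₂
      rw [T.dist_comm (u := c)] at hy₂ hle
      exact hT.smul_eq_self_of_le_gromovProduct (zpow_smul_eq_self hh _) (p := c) (by omega)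
        (by omega)
  have hadd := fun p ↦ hT.isTree.gromovProduct_add c c' p
  refine IsFreeGroup.of_zpow_ping_pong hgen (X := {p | T.gromovProduct c c' p ≤ k})
    (Y := {p | k < T.gromovProduct c c' p}) ⟨c, ?_⟩ ⟨c', ?_⟩ ?_ ?_ ?_
  · simp [hT.gromovProduct_base_right]
  · simp only [Set.mem_ofPred_eq, hT.gromovProduct_self_right]
    omega
  · exact Set.disjoint_left.2 fun p hp hp' ↦ (not_le.2 (show k < _ from hp')) hp
  · intro n hn p hp
    by_contra hp'
    simp only [Set.mem_ofPred_eq, not_le] at hp hp'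
    rw [← hT.gromovProduct_smul (g ^ n), zpow_smul_eq_self hg, T.gromovProduct_comm] at hp
    have := hT.isTree.le_gromovProduct_trans hp' hp
    have := hkmax n hn
    omega
  · intro n hn p hp
    by_contra hp'
    simp only [Set.mem_ofPred_eq, not_lt] at hp hp'
    have h₁ := hadd p
    have h₂ := hadd (h ^ n • p)
    have h₃ : l < T.gromovProduct c' c p := by omega
    rw [← hT.gromovProduct_smul (h ^ n), zpow_smul_eq_self hh, T.gromovProduct_comm] at h₃
    have h₄ : l < T.gromovProduct c' c (h ^ n • p) := by omega
    have := hT.isTree.le_gromovProduct_trans h₄ h₃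
    have := hlmax n hn
    omega

/-- An elliptic element `g` whose nontrivial powers have their fixed points in the unit ball
around a fixed point of `g`, and an element `h` which translates the set of these points off
itself, generate a free group provided that no `g ^ n * h` is elliptic. -/
theorem isFreeGroup_of_elliptic_hyperbolic (hT : IsTreeAction G T) {g h : G} {c : V}
    (hgen : Subgroup.closure {g, h} = ⊤) (hg : g • c = c)
    (hcenter : ∀ (p : V) (n : ℤ), n ≠ 0 → g ^ n • p = p → T.dist c p ≤ 1)
    (hhyp : ∀ (n : ℤ) (z : V), (g ^ n * h) • z ≠ z)
    (hdisj : ∀ (p : V) (n m : ℤ), n ≠ 0 → m ≠ 0 → g ^ n • p = p → g ^ m • h⁻¹ • p ≠ h⁻¹ • p) :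
    IsFreeGroup G := by
  have hgc := zpow_smul_eq_self hg
  have heven := hT.even_dist_smul h c
  have hinv := hT.dist_self_inv_smul h c
  have hpos : T.dist c (h • c) ≠ 0 := fun h₀ ↦ hhyp 0 c (by simp [← hT.eq_of_dist_eq_zero h₀])
  obtain ⟨k, hk, hkmax, n₀, hn₀, hkn⟩ :=
    hT.exists_max_gromovProduct_zpow (g := g) (c := c) (h • c)
  obtain ⟨l, hl, hlmax, m₀, hm₀, hlm⟩ :=
    hT.exists_max_gromovProduct_zpow (g := g) (c := c) (h⁻¹ • c)
  obtain ⟨y, hy₁, hy₂⟩ := hT.isTree.exists_between c (h • c) hk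
  have hy : g ^ n₀ • y = y :=
    hT.smul_eq_self_of_le_gromovProduct (hgc _) (p := h • c) (by omega) (by omega)
  obtain ⟨z, hz₁, hz₂⟩ := hT.isTree.exists_between c (h⁻¹ • c) hl
  have hz : g ^ m₀ • z = z :=
    hT.smul_eq_self_of_le_gromovProduct (hgc _) (p := h⁻¹ • c) (by omega) (by omega)
  have hk₁ := hcenter y n₀ hn₀ hy
  have hl₁ := hcenter z m₀ hm₀ hz
  have hkl : k + l < T.dist c (h • c) := by
    by_contra! hle
    refine hdisj y n₀ m₀ hn₀ hm₀ hy ?_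
    have h₁ : T.dist c (h⁻¹ • y) = T.dist y (h • c) := by
      rw [T.dist_comm, hT.dist_inv_smul]
    have h₂ : T.dist (h⁻¹ • y) (h⁻¹ • c) = T.dist c y := by
      rw [hT.dist_smul_smul, T.dist_comm]
    exact hT.smul_eq_self_of_le_gromovProduct (hgc _) (p := h⁻¹ • c) (by omega) (by omega)
  have hmix : ∀ n : ℤ, 2 * T.gromovProduct c (g ^ n • h • c) (h⁻¹ • c) < T.dist c (h • c) := by
    intro n
    by_contra! hle
    obtain ⟨z, hz⟩ := hT.exists_fixed_of_le_two_mul_gromovProduct (h := g ^ n * h) (c := c) (by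
      rwa [mul_inv_rev, mul_smul, mul_smul, ← zpow_neg, hgc, ← hT.dist_smul_smul (g ^ (-n)), hgc,
        zpow_neg, inv_smul_smul])
    exact hhyp n z hz
  obtain ⟨r, s, hkr, hls, hrs, hmrs⟩ : ∃ r s, k ≤ r ∧ l ≤ s ∧ r + s < T.dist c (h • c) ∧
      ∀ m, 2 * m < T.dist c (h • c) → m ≤ r ∧ m ≤ s := by
    obtain ⟨b, hb⟩ := heven
    by_cases hb₁ : b = 1
    · exact ⟨k, l, le_rfl, le_rfl, hkl, fun m hm ↦ by omega⟩
    · exact ⟨b - 1, b - 1, by omega, by omega, by omega, fun m hm ↦ by omega⟩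
  have hcross : ∀ {n : ℤ} {p q q' : V} {t : ℕ}, t ≤ T.gromovProduct c q p →
      t ≤ T.gromovProduct c q' (g ^ n • p) → t ≤ T.gromovProduct c q' (g ^ n • q) := by
    intro n p q q' t h₁ h₂
    rw [← hT.gromovProduct_smul (g ^ n), hgc, T.gromovProduct_comm] at h₁
    exact hT.isTree.le_gromovProduct_trans h₂ h₁
  have hUV : ∀ {n : ℤ} {p : V}, r < T.gromovProduct c (h • c) p →
      ¬ s < T.gromovProduct c (h⁻¹ • c) (g ^ n • p) := by
    intro n p h₁ h₂
    have h₃ := hcross (n := n) (p := p) (q := h • c) (q' := h⁻¹ • c) (t := min r s + 1)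
      (by omega) (by omega)
    rw [T.gromovProduct_comm] at h₃
    have := hmrs _ (hmix n)
    omega
  have hVU : ∀ {n : ℤ} {p : V}, s < T.gromovProduct c (h⁻¹ • c) p →
      ¬ r < T.gromovProduct c (h • c) (g ^ n • p) := by
    intro n p h₁ h₂
    refine hUV (n := -n) h₂ ?_
    rwa [zpow_neg, inv_smul_smul]
  let Y : Set V := {p | r < T.gromovProduct c (h • c) p ∨ s < T.gromovProduct c (h⁻¹ • c) p}
  refine IsFreeGroup.of_zpow_ping_pong hgen (X := Yᶜ) (Y := Y) ⟨c, ?_⟩ ⟨h • c, Or.inl ?_⟩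
    disjoint_compl_left ?_ ?_
  · simp [Y, hT.gromovProduct_base_right]
  · rw [hT.gromovProduct_self_right]
    omega
  · rintro n hn p (hp | hp) (hp' | hp')
    · have := hcross hp hp'
      have := hkmax n hn
      omega
    · exact hUV hp hp'
    · exact hVU hp hp'
    · have := hcross hp hp'
      have := hlmax n hn
      omega
  · intro n hn p hp
    simp only [Y, Set.mem_compl_iff, Set.mem_ofPred_eq, not_or, not_lt] at hp
    have := hmrs _ (hmix 0)
    rw [zpow_zero, one_smul] at this
    exact hT.lt_gromovProduct_zpow_smul hrs (by omega) hn hp.1 hp.2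

end IsTreeAction

/-- The generating pair `(g, h)` and the vertex `x` minimize the total displacement of the vertex
by the pair. -/
structure IsMinimalPair {G V : Type*} [Group G] [MulAction G V] (T : SimpleGraph V) (x : V)
    (g h : G) : Prop where
  closure_eq : Subgroup.closure {g, h} = ⊤
  le : ∀ (x' : V) (g' h' : G), Subgroup.closure {g', h'} = ⊤ →
    T.dist x (g • x) + T.dist x (h • x) ≤ T.dist x' (g' • x') + T.dist x' (h' • x')

namespace IsMinimalPair

variable {G V : Type*} [Group G] [MulAction G V] {T : SimpleGraph V} {x : V} {g h : G}

theorem swap (hm : IsMinimalPair T x g h) : IsMinimalPair T x h g where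
  closure_eq := by rw [Set.pair_comm, hm.closure_eq]
  le := by simpa only [add_comm (T.dist x (h • x))] using hm.le

theorem of_dist_eq (hm : IsMinimalPair T x g h) {g' h' : G}
    (hgen : Subgroup.closure {g', h'} = ⊤) (hg : T.dist x (g' • x) = T.dist x (g • x))
    (hh : T.dist x (h' • x) = T.dist x (h • x)) : IsMinimalPair T x g' h' where
  closure_eq := hgen
  le := by simpa only [hg, hh] using hm.le

theorem closure_mul_right (hm : IsMinimalPair T x g h) :
    Subgroup.closure {g, g⁻¹ * h} = ⊤ := by
  have hg : g ∈ Subgroup.closure {g, g⁻¹ * h} := Subgroup.subset_closure (by simp)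
  have hh : g⁻¹ * h ∈ Subgroup.closure {g, g⁻¹ * h} := Subgroup.subset_closure (by simp)
  exact Subgroup.closure_pair_eq_top_of_mem hm.closure_eq hg
    (by simpa using Subgroup.mul_mem _ hg hh)

theorem inv_left (hm : IsMinimalPair T x g h) (hT : IsTreeAction G T) :
    IsMinimalPair T x g⁻¹ h := by
  refine hm.of_dist_eq ?_ (hT.dist_self_inv_smul g x) rfl
  have hg : g⁻¹ ∈ Subgroup.closure {g⁻¹, h} := Subgroup.subset_closure (by simp)
  exact Subgroup.closure_pair_eq_top_of_mem hm.closure_eq (by simpa using hg)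
    (Subgroup.subset_closure (by simp))

theorem inv_right (hm : IsMinimalPair T x g h) (hT : IsTreeAction G T) :
    IsMinimalPair T x g h⁻¹ :=
  (hm.swap.inv_left hT).swap

theorem dist_inv_mul (hT : IsTreeAction G T) (g h : G) (x : V) :
    T.dist x ((g⁻¹ * h) • x) = T.dist (g • x) (h • x) := by
  rw [mul_smul, ← hT.dist_smul_smul g x, smul_inv_smul]

theorem gromovProduct_eq_zero (hm : IsMinimalPair T x g h) (hT : IsTreeAction G T)
    (hg : 1 ≤ T.gromovProduct x (g • x) (g⁻¹ • x)) : T.gromovProduct x (g • x) (h • x) = 0 := by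
  by_contra! hne
  obtain ⟨y, hy₁, hy₂, hy₃⟩ := hT.isTree.exists_common_between hg
  obtain ⟨z, hz₁, hz₂, hz₃⟩ := hT.isTree.exists_common_between (Nat.one_le_iff_ne_zero.2 hne)
  obtain rfl : y = z :=
    hT.isTree.eq_of_between (x := x) (y := g • x) (by omega) (by omega) (by omega)
  obtain ⟨a, ha⟩ := hT.even_dist_smul g x
  have h₁ : T.dist x (g • y) = T.dist y (g⁻¹ • x) := by
    rw [T.dist_comm (u := y), hT.dist_inv_smul]
  have h₂ : T.dist (g • x) (g • y) = 1 := by rw [hT.dist_smul_smul, hy₁]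
  have h₃ := hT.isTree.dist_add_two_mul_gromovProduct x (g • x) (g • y)
  have h₄ := hT.dist_self_inv_smul g x
  obtain ⟨w, hw₁, hw₂, hw₃⟩ := hT.isTree.exists_common_between
    (show 1 ≤ T.gromovProduct x (g • x) (g • y) by omega)
  obtain rfl : w = y :=
    hT.isTree.eq_of_between (x := x) (y := g • x) (by omega) (by omega) (by omega)
  have h₅ : T.dist (h • x) (h • w) = 1 := by rw [hT.dist_smul_smul, hy₁]
  have h₆ := hT.triangle w (h • x) (h • w)
  have := hm.le w g h hm.closure_eq
  omega

theorem two_mul_gromovProduct_le (hm : IsMinimalPair T x g h) (hT : IsTreeAction G T) :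
    2 * T.gromovProduct x (g • x) (h • x) ≤ T.dist x (g • x) := by
  have h₁ := hm.le x g (g⁻¹ * h) hm.closure_mul_right
  have h₂ := hT.isTree.dist_add_two_mul_gromovProduct x (g • x) (h • x)
  rw [dist_inv_mul hT] at h₁
  omega

theorem two_mul_gromovProduct_lt (hm : IsMinimalPair T x g h) (hT : IsTreeAction G T)
    (h₁ : 1 ≤ T.gromovProduct x (g • x) (h • x))
    (h₂ : 1 ≤ T.gromovProduct x (g⁻¹ • x) (h⁻¹ • x)) :
    2 * T.gromovProduct x (g • x) (h • x) < T.dist x (g • x) := by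
  by_contra! hle
  have hle' := hm.two_mul_gromovProduct_le hT
  have hle'' := hm.swap.two_mul_gromovProduct_le hT
  rw [T.gromovProduct_comm] at hle''
  have h₃ := hT.isTree.dist_add_two_mul_gromovProduct x (g • x) (h • x)
  have hm' : IsMinimalPair T x g (g⁻¹ * h) :=
    hm.of_dist_eq hm.closure_mul_right rfl (by rw [dist_inv_mul hT]; omega)
  have h₄ : 1 ≤ T.gromovProduct x (g⁻¹ • x) ((g⁻¹ * h) • x) := by
    have := hT.isTree.gromovProduct_add x (g • x) (h • x)
    rw [mul_smul, ← hT.gromovProduct_smul g, smul_inv_smul, smul_inv_smul]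
    omega
  have h₅ : 1 ≤ T.gromovProduct x ((g⁻¹ * h)⁻¹ • x) (h⁻¹ • x) := by
    have := hT.isTree.gromovProduct_add x (h • x) (g • x)
    rw [T.gromovProduct_comm x] at this
    rw [mul_inv_rev, inv_inv, mul_smul, ← hT.gromovProduct_smul h, smul_inv_smul, smul_inv_smul,
      T.gromovProduct_comm]
    omega
  rw [T.gromovProduct_comm] at h₄ h₅
  have h₆ := hT.isTree.le_gromovProduct_trans h₄ (hT.isTree.le_gromovProduct_trans h₂ h₅)
  have := (hm'.swap.inv_right hT).gromovProduct_eq_zero hT h₆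
  omega

/-- Unless one of the elements is elliptic, the four directions of a minimal pair are separated by
balls of radii less than the displacements. -/
theorem exists_radii (hm : IsMinimalPair T x g h) (hT : IsTreeAction G T)
    (hhyp : ∀ z : V, g • z ≠ z) : ∃ r s, r + s < T.dist x (g • x) ∧
      T.gromovProduct x (g • x) (g⁻¹ • x) ≤ min r s ∧ T.gromovProduct x (g • x) (h • x) ≤ r ∧
      T.gromovProduct x (g • x) (h⁻¹ • x) ≤ r ∧ T.gromovProduct x (g⁻¹ • x) (h • x) ≤ s ∧
      T.gromovProduct x (g⁻¹ • x) (h⁻¹ • x) ≤ s := by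
  have hm₁ := hm.inv_right hT
  have hm₂ := hm.inv_left hT
  have hm₃ := hm₁.inv_left hT
  have hpos : T.dist x (g • x) ≠ 0 := fun h₀ ↦ hhyp x (hT.eq_of_dist_eq_zero h₀).symm
  have hgg : 2 * T.gromovProduct x (g • x) (g⁻¹ • x) < T.dist x (g • x) := by
    by_contra! hle
    obtain ⟨z, hz⟩ := hT.exists_fixed_of_le_two_mul_gromovProduct hle
    exact hhyp z hz
  have hcomm := T.gromovProduct_comm (V := V) x
  have zero₀ := hm.gromovProduct_eq_zero hT
  have zero₁ := hm₁.gromovProduct_eq_zero hT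
  have zero₂ := hm₂.gromovProduct_eq_zero hT
  have zero₃ := hm₃.gromovProduct_eq_zero hT
  have zero₀' := hm.swap.gromovProduct_eq_zero hT
  have zero₂' := hm₂.swap.gromovProduct_eq_zero hT
  have le₀ := hm.two_mul_gromovProduct_le hT
  have le₁ := hm₁.two_mul_gromovProduct_le hT
  have le₂ := hm₂.two_mul_gromovProduct_le hT
  have le₃ := hm₃.two_mul_gromovProduct_le hT
  have lt₀ := hm.two_mul_gromovProduct_lt hT
  have lt₁ := hm₁.two_mul_gromovProduct_lt hT
  have lt₂ := hm₂.two_mul_gromovProduct_lt hT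
  have lt₃ := hm₃.two_mul_gromovProduct_lt hT
  have hd := hT.dist_self_inv_smul g x
  have trans : ∀ {p q r : V}, 1 ≤ T.gromovProduct x p q → 1 ≤ T.gromovProduct x q r →
    1 ≤ T.gromovProduct x p r := fun h₁ h₂ ↦ hT.isTree.le_gromovProduct_trans h₁ h₂
  have t₀ := trans (p := h • x) (q := g • x) (r := h⁻¹ • x)
  have t₁ := trans (p := h • x) (q := g⁻¹ • x) (r := h⁻¹ • x)
  have t₂ := trans (p := g • x) (q := h • x) (r := g⁻¹ • x)
  have t₃ := trans (p := g • x) (q := h⁻¹ • x) (r := g⁻¹ • x)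
  simp only [inv_inv, hcomm (h • x) (g • x), hcomm (h • x) (g⁻¹ • x), 
    hcomm (h⁻¹ • x) (g⁻¹ • x), hcomm (g⁻¹ • x) (g • x), hd] at *
  generalize T.gromovProduct x (g • x) (g⁻¹ • x) = gg at *
  generalize T.gromovProduct x (h • x) (h⁻¹ • x) = hh at *
  generalize T.gromovProduct x (g • x) (h • x) = a at *
  generalize T.gromovProduct x (g • x) (h⁻¹ • x) = b at *
  generalize T.gromovProduct x (g⁻¹ • x) (h • x) = c at *
  generalize T.gromovProduct x (g⁻¹ • x) (h⁻¹ • x) = d at *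
  refine ⟨max gg (max a b), max gg (max c d), ?_, ?_⟩ <;> omega

end IsMinimalPair

namespace IsTreeAction

variable {G V : Type*} [Group G] [MulAction G V] {T : SimpleGraph V}

theorem exists_isMinimalPair (hT : IsTreeAction G T)
    (hex : ∃ g h : G, Subgroup.closure {g, h} = ⊤) :
    ∃ (x : V) (g h : G), IsMinimalPair T x g h := by
  classical
  obtain ⟨x₀⟩ := hT.isTree.connected.nonempty
  obtain ⟨g₀, h₀, hgen⟩ := hex
  have hP : ∃ (n : ℕ) (x : V) (g h : G), Subgroup.closure {g, h} = ⊤ ∧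
    T.dist x (g • x) + T.dist x (h • x) = n := ⟨_, x₀, g₀, h₀, hgen, rfl⟩
  obtain ⟨x, g, h, hgh, heq⟩ := Nat.find_spec hP
  exact ⟨x, g, h, hgh, fun x' g' h' hgen' ↦
    heq.trans_le (Nat.find_min' hP ⟨x', g', h', hgen', rfl⟩)⟩

/-- If no element of a generating pair of `G` is ever elliptic and `G` is generated by two
elements, then `G` is free. -/
theorem isFreeGroup_of_hyperbolic_hyperbolic (hT : IsTreeAction G T)
    (hex : ∃ g h : G, Subgroup.closure {g, h} = ⊤)
    (hhyp : ∀ g h : G, Subgroup.closure {g, h} = ⊤ → ∀ z : V, g • z ≠ z) : IsFreeGroup G := by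
  obtain ⟨x, g, h, hm⟩ := hT.exists_isMinimalPair hex
  obtain ⟨r, r', hr, hgg, ha, hb, hc, hd⟩ := hm.exists_radii hT (hhyp g h hm.closure_eq)
  obtain ⟨s, s', hs, hhh, ha', hc', hb', hd'⟩ :=
    hm.swap.exists_radii hT (hhyp h g hm.swap.closure_eq)
  have hcomm := T.gromovProduct_comm (V := V) x
  have hdisj : ∀ {a b p : V} {m n : ℕ}, T.gromovProduct x a b ≤ m → T.gromovProduct x a b ≤ n →
      m < T.gromovProduct x a p → T.gromovProduct x b p ≤ n := by
    intro a b p m n hm hn hp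
    by_contra! hp'
    rw [hcomm] at hp'
    have := hT.isTree.le_gromovProduct_trans (k := min m n + 1) (w := x) (x := a) (y := p)
      (z := b) (by omega) (by omega)
    omega
  rw [hcomm] at ha' hb' hc' hd'
  refine IsFreeGroup.of_zpow_ping_pong hm.closure_eq
    (X := {p | r < T.gromovProduct x (g • x) p ∨ r' < T.gromovProduct x (g⁻¹ • x) p})
    (Y := {p | s < T.gromovProduct x (h • x) p ∨ s' < T.gromovProduct x (h⁻¹ • x) p})
    ⟨g • x, Or.inl ?_⟩ ⟨h • x, Or.inl ?_⟩ ?_ ?_ ?_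
  · rw [hT.gromovProduct_self_right]
    omega
  · rw [hT.gromovProduct_self_right]
    omega
  · refine Set.disjoint_left.2 ?_
    rintro p (hp | hp) (hp' | hp')
    · exact (hdisj ha ha' hp).not_gt hp'
    · exact (hdisj hb hb' hp).not_gt hp'
    · exact (hdisj hc hc' hp).not_gt hp'
    · exact (hdisj hd hd' hp).not_gt hp'
  · rintro n hn p (hp | hp)
    · refine hT.lt_gromovProduct_zpow_smul hr hgg hn (hdisj ?_ ?_ hp) (hdisj ?_ ?_ hp) <;>
        rwa [hcomm]
    · refine hT.lt_gromovProduct_zpow_smul hr hgg hn (hdisj ?_ ?_ hp) (hdisj ?_ ?_ hp) <;>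
        rwa [hcomm]
  · rintro n hn p (hp | hp)
    · exact hT.lt_gromovProduct_zpow_smul hs hhh hn (hdisj ha ha' hp) (hdisj hb hb' hp)
    · exact hT.lt_gromovProduct_zpow_smul hs hhh hn (hdisj hc hc' hp) (hdisj hd hd' hp)

end IsTreeAction

theorem Subgroup.exists_pow_mem_of_zpow_mem {G : Type*} [Group G] {H : Subgroup G} {g : G} {n : ℤ}
    (hn : n ≠ 0) (h : g ^ n ∈ H) : ∃ k : ℕ, 1 ≤ k ∧ g ^ k ∈ H := by
  refine ⟨n.natAbs, by omega, ?_⟩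
  obtain hn | hn := n.natAbs_eq
  · rwa [hn, zpow_natCast] at h
  · rwa [hn, zpow_neg, zpow_natCast, inv_mem_iff] at h

/-- An action of a torsion-free group on a tree which is transitive on the neighbours of each
vertex, without global fixed points, and such that only the identity fixes two
vertices at distance at least three. -/
structure IsAcylindricalAction (G : Type*) {V : Type*} [Group G] [MulAction G V]
    (T : SimpleGraph V) : Prop extends IsTreeAction G T where
  exists_smul_eq {v x y : V} : T.Adj v x → T.Adj v y → ∃ b : G, b • v = v ∧ b • x = y
  eq_one {g : G} {x y : V} : g • x = x → g • y = y → 3 ≤ T.dist x y → g = 1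
  exists_smul_ne (x : V) : ∃ g : G, g • x ≠ x
  eq_one_of_pow_eq_one (g : G) (n : ℕ) : 1 ≤ n → g ^ n = 1 → g = 1

namespace IsAcylindricalAction

open MulAction

variable {G V : Type*} [Group G] [MulAction G V] {T : SimpleGraph V} {g h : G}

theorem smul_ne_of_closure_eq_top (hT : IsAcylindricalAction G T)
    (hgen : Subgroup.closure {g, h} = ⊤) {x : V} (hg : g • x = x) : h • x ≠ x := by
  intro hh
  obtain ⟨k, hk⟩ := hT.exists_smul_ne x
  have hle : Subgroup.closure {g, h} ≤ stabilizer G x := by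
    rw [Subgroup.closure_le]
    rintro _ (rfl | rfl) <;> assumption
  exact hk (hle (hgen ▸ Subgroup.mem_top k))

theorem pow_ne_one (hT : IsAcylindricalAction G T) (hg : g ≠ 1) {n : ℕ} (hn : 1 ≤ n) :
    g ^ n ≠ 1 :=
  fun h₁ ↦ hg (hT.eq_one_of_pow_eq_one g n hn h₁)

theorem zpow_ne_one (hT : IsAcylindricalAction G T) (hg : g ≠ 1) {n : ℤ} (hn : n ≠ 0) :
    g ^ n ≠ 1 := by
  intro h₁
  obtain ⟨k, hk, hgk⟩ := Subgroup.exists_pow_mem_of_zpow_mem hn (Subgroup.mem_bot.2 h₁)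
  exact hT.pow_ne_one hg hk (Subgroup.mem_bot.1 hgk)

theorem dist_le_two (hT : IsAcylindricalAction G T) (hg : g ≠ 1) {p q : V} {n m : ℤ} (hn : n ≠ 0)
    (hm : m ≠ 0) (hp : g ^ n • p = p) (hq : g ^ m • q = q) : T.dist p q ≤ 2 := by
  by_contra! hlt
  have h₁ : g ^ (n * m) • p = p := by
    rw [zpow_mul]
    exact IsTreeAction.zpow_smul_eq_self hp m
  have h₂ : g ^ (n * m) • q = q := by
    rw [mul_comm, zpow_mul]
    exact IsTreeAction.zpow_smul_eq_self hq n
  exact hT.zpow_ne_one hg (mul_ne_zero hn hm) (hT.eq_one h₁ h₂ hlt)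

/-- The vertices fixed by some nontrivial power of a nontrivial elliptic element `g` lie in the
unit ball around a fixed vertex of `g`. -/
theorem exists_center (hT : IsAcylindricalAction G T) (hg : g ≠ 1) {c : V} (hc : g • c = c) :
    ∃ c' : V, g • c' = c' ∧ ∀ (p : V) (n : ℤ), n ≠ 0 → g ^ n • p = p → T.dist c' p ≤ 1 := by
  by_contra! hcon
  obtain ⟨y, n, hn, hy, hcy⟩ := hcon c hc
  have hcy' := hT.dist_le_two hg one_ne_zero hn (by rwa [zpow_one]) hy
  obtain ⟨m, hm₁, hm₂⟩ := hT.isTree.exists_between c y (k := 1) (by omega)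
  have hm : g • m = m := by
    have h₁ : g ^ n • g • y = g • y := by
      rw [← mul_smul, (Commute.refl g).zpow_left n |>.eq, mul_smul, hy]
    have h₂ := hT.dist_le_two hg hn hn hy h₁
    have h₃ := hT.isTree.dist_add_two_mul_gromovProduct c y (g • y)
    have h₄ : T.dist c (g • y) = T.dist c y := by rw [← hT.dist_smul_smul g c y, hc]
    exact hT.smul_eq_self_of_le_gromovProduct hc (p := y) (by omega) (by omega)
  obtain ⟨p, k, hk, hp, hmp⟩ := hcon m hm
  have h₁ := hT.dist_le_two hg one_ne_zero hk (by rwa [zpow_one]) hp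
  have h₂ := hT.dist_le_two hg one_ne_zero hk (by rwa [zpow_one]) hp (p := c)
  have h₃ := hT.dist_le_two hg hn hk hy hp
  have h₄ := hT.isTree.even_perimeter c m p
  have h₅ := hT.isTree.even_perimeter m y p
  rw [Nat.even_iff] at h₄ h₅
  rw [T.dist_comm (u := y)] at h₃ h₅
  have h₆ := hT.triangle c p y
  have : m = p := hT.isTree.eq_of_between (x := c) (y := y) (by omega) (by omega) (by omega)
  rw [this, T.dist_self] at hmp
  omega

/-- The subgroups in the conclusion are the stabilizers of an edge and of its two ends. -/
def HasAdaptedPair (G : Type*) {V : Type*} [Group G] [MulAction G V] (T : SimpleGraph V) : Prop :=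
  ∃ p q : V, T.Adj p q ∧ AmalgamGeneratingPairConclusion (stabilizer G p ⊓ stabilizer G q)
    (stabilizer G p) (stabilizer G q)

theorem hasAdaptedPair_of_adj (hT : IsAcylindricalAction G T)
    (hgen : Subgroup.closure {g, h} = ⊤) {c c' : V} (hcc : T.Adj c c') (hg : g • c = c)
    (hh : h • c' = c') (hg₁ : g ≠ 1) {n : ℤ} (hn : n ≠ 0) (hgn : g ^ n • c' = c') :
    HasAdaptedPair G T := by
  obtain ⟨k, hk, hgk⟩ := Subgroup.exists_pow_mem_of_zpow_mem (H := stabilizer G c') hn hgn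
  refine ⟨c, c', hcc, g, h, hgen, hg, ⟨k, hk, ⟨pow_mem hg k, hgk⟩, hT.pow_ne_one hg₁ hk⟩,
    Or.inl ⟨hh, fun hh' ↦ ?_⟩⟩
  exact hT.smul_ne_of_closure_eq_top hgen hg hh'.1

theorem hasAdaptedPair_of_elliptic_elliptic (hT : IsAcylindricalAction G T)
    (hfree : ¬ IsFreeGroup G) (hgen : Subgroup.closure {g, h} = ⊤) {x x' : V} (hg : g • x = x)
    (hh : h • x' = x') : HasAdaptedPair G T := by
  have hg₁ : g ≠ 1 := by
    rintro rfl
    exact hT.smul_ne_of_closure_eq_top hgen (one_smul _ _) hh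
  have hh₁ : h ≠ 1 := by
    rintro rfl
    exact hT.smul_ne_of_closure_eq_top hgen hg (one_smul _ _)
  obtain ⟨c, hc, hcg⟩ := hT.exists_center hg₁ hg
  obtain ⟨c', hc', hch⟩ := hT.exists_center hh₁ hh
  have hcc : c ≠ c' := by
    rintro rfl
    exact hT.smul_ne_of_closure_eq_top hgen hc hc'
  obtain ⟨v, n, m, hn, hm, hgn, hhm⟩ : ∃ (v : V) (n m : ℤ), n ≠ 0 ∧ m ≠ 0 ∧ g ^ n • v = v ∧
      h ^ m • v = v := by
    by_contra! hcon
    exact hfree (hT.isFreeGroup_of_elliptic_elliptic hgen hc hc' hcon)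
  have hcv := hcg v n hn hgn
  have hcv' := hch v m hm hhm
  rcases Nat.le_one_iff_eq_zero_or_eq_one.1 hcv with hcv | hcv
  · obtain rfl := hT.eq_of_dist_eq_zero hcv
    refine hT.hasAdaptedPair_of_adj (by rwa [Set.pair_comm]) ?_ hc' hc hh₁ hm hhm
    rw [← T.dist_eq_one_iff_adj]
    have : T.dist c' c ≠ 0 := fun h₀ ↦ hcc (hT.eq_of_dist_eq_zero h₀).symm
    omega
  rcases Nat.le_one_iff_eq_zero_or_eq_one.1 hcv' with hcv' | hcv'
  · obtain rfl := hT.eq_of_dist_eq_zero hcv'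
    exact hT.hasAdaptedPair_of_adj hgen (T.dist_eq_one_iff_adj.1 hcv) hc hc' hg₁ hn hgn
  rw [T.dist_eq_one_iff_adj] at hcv hcv'
  obtain ⟨b, hbv, hbc⟩ := hT.exists_smul_eq hcv.symm hcv'.symm
  obtain ⟨k, hk, hgk⟩ := Subgroup.exists_pow_mem_of_zpow_mem (H := stabilizer G v) hn hgn
  obtain ⟨l, hl, hhl⟩ := Subgroup.exists_pow_mem_of_zpow_mem (H := stabilizer G v) hm hhm
  have ha : b⁻¹ * h * b ∈ stabilizer G c := by
    rw [mem_stabilizer_iff, mul_smul, hbc, mul_smul, hc', ← hbc, inv_smul_smul]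
  have hal : (b⁻¹ * h * b) ^ l = b⁻¹ * h ^ l * b := by
    simpa using conj_pow (i := l) (a := b⁻¹) (b := h)
  refine ⟨c, v, hcv, g, h, hgen, hc, ⟨k, hk, ⟨pow_mem hc k, hgk⟩, hT.pow_ne_one hg₁ hk⟩,
    Or.inr (Or.inr ⟨b⁻¹ * h * b, b, ha, hbv, by group, l, hl, ⟨pow_mem ha l, ?_⟩,
      hT.pow_ne_one ?_ hl⟩)⟩
  · have hbv' : b ∈ stabilizer G v := hbv
    rw [hal]
    exact (stabilizer G v).mul_mem (mul_mem (inv_mem hbv') hhl) hbv'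
  · intro h₁
    exact hh₁ (by simpa [mul_assoc] using congrArg (fun z ↦ b * z * b⁻¹) h₁)

theorem isFreeGroup_of_closure_one (hT : IsAcylindricalAction G T)
    (hgen : Subgroup.closure {1, h} = ⊤)
    (hh : h ≠ 1) : IsFreeGroup G := by
  refine IsFreeGroup.of_injective_lift (fun _ : Unit ↦ h) ?_ ?_
  · rw [injective_iff_map_eq_one, FreeGroup.freeGroupUnitEquivInt.forall_congr_left]
    intro n hn
    change FreeGroup.lift (fun _ ↦ h) (FreeGroup.of () ^ n) = 1 at hn
    rw [map_zpow, FreeGroup.lift_apply_of] at hn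
    obtain rfl : n = 0 := by
      by_contra hn₀
      exact hT.zpow_ne_one hh hn₀ hn
    simp [FreeGroup.freeGroupUnitEquivInt]
  · rw [Set.range_const, ← hgen, Subgroup.closure_insert_one]

theorem hasAdaptedPair_of_elliptic_hyperbolic (hT : IsAcylindricalAction G T)
    (hfree : ¬ IsFreeGroup G) (hgen : Subgroup.closure {g, h} = ⊤) {x : V} (hg : g • x = x)
    (hhyp : ∀ (n : ℤ) (z : V), (g ^ n * h) • z ≠ z) : HasAdaptedPair G T := by
  have hg₁ : g ≠ 1 := by
    rintro rfl
    refine hfree (hT.isFreeGroup_of_closure_one hgen ?_)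
    rintro rfl
    exact hhyp 0 x (by simp)
  obtain ⟨c, hc, hcg⟩ := hT.exists_center hg₁ hg
  obtain ⟨v, n, m, hn, hm, hgn, hgm⟩ : ∃ (v : V) (n m : ℤ), n ≠ 0 ∧ m ≠ 0 ∧ g ^ n • v = v ∧
      g ^ m • h⁻¹ • v = h⁻¹ • v := by
    by_contra! hcon
    exact hfree (hT.isFreeGroup_of_elliptic_hyperbolic hgen hc hcg hhyp hcon)
  have hcv := hcg v n hn hgn
  have hcu := hcg _ m hm hgm
  have huv := hT.triangle v c (h⁻¹ • v)
  have hne : T.dist v (h⁻¹ • v) ≠ 0 := by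
    intro h₀
    refine hhyp 0 v ?_
    nth_rw 1 [hT.eq_of_dist_eq_zero h₀]
    simp
  obtain ⟨k, hk⟩ := hT.even_dist_smul h⁻¹ v
  rw [T.dist_comm (u := v) (v := c)] at huv
  have hcv' : T.Adj c v := T.dist_eq_one_iff_adj.1 (by omega)
  have hcu' : T.Adj c (h⁻¹ • v) := T.dist_eq_one_iff_adj.1 (by omega)
  obtain ⟨a, hac, hau⟩ := hT.exists_smul_eq hcu' hcv'
  obtain ⟨i, hi, hgi⟩ := Subgroup.exists_pow_mem_of_zpow_mem (H := stabilizer G (h⁻¹ • v)) hm hgm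
  obtain ⟨j, hj, hgj⟩ := Subgroup.exists_pow_mem_of_zpow_mem (H := stabilizer G v) hn hgn
  have hac' : a ∈ stabilizer G c := hac
  refine ⟨c, h⁻¹ • v, hcu', g, h, hgen, hc, ⟨i, hi, ⟨pow_mem hc i, hgi⟩, hT.pow_ne_one hg₁ hi⟩,
    Or.inr (Or.inl ⟨a, a⁻¹ * h, hac, fun ha ↦ ?_, ?_, fun hb ↦ ?_, by group, j, hj,
      (stabilizer G c).mul_mem (mul_mem (inv_mem hac') (pow_mem hc j)) hac', ?_⟩)⟩
  · refine hne ?_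
    rw [← show a • h⁻¹ • v = h⁻¹ • v from ha.2, hau, T.dist_self]
  · rw [mem_stabilizer_iff, mul_smul, smul_inv_smul, inv_smul_eq_iff, hau]
  · refine hhyp 0 c ?_
    have hb' : (a⁻¹ * h) • c = c := hb.1
    rwa [mul_smul, inv_smul_eq_iff, hac, ← one_mul h, ← zpow_zero g] at hb'
  · change (a⁻¹ * g ^ j * a) • h⁻¹ • v = h⁻¹ • v
    rw [mul_smul, hau, mul_smul, hgj, inv_smul_eq_iff, hau]

theorem hasAdaptedPair (hT : IsAcylindricalAction G T) (hfree : ¬ IsFreeGroup G)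
    (hex : ∃ g h : G, Subgroup.closure {g, h} = ⊤) : HasAdaptedPair G T := by
  obtain ⟨g, h, hgen, x, hx⟩ : ∃ g h : G, Subgroup.closure {g, h} = ⊤ ∧ ∃ x : V, g • x = x := by
    by_contra! hcon
    exact hfree (hT.isFreeGroup_of_hyperbolic_hyperbolic hex hcon)
  by_cases hell : ∃ (n : ℤ) (z : V), (g ^ n * h) • z = z
  · obtain ⟨n, z, hz⟩ := hell
    refine hT.hasAdaptedPair_of_elliptic_elliptic hfree (g := g) (h := g ^ n * h) ?_ hx hz
    have hg : g ∈ Subgroup.closure {g, g ^ n * h} := Subgroup.subset_closure (by simp)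
    have hh : g ^ n * h ∈ Subgroup.closure {g, g ^ n * h} := Subgroup.subset_closure (by simp)
    exact Subgroup.closure_pair_eq_top_of_mem hgen hg
      (by simpa using mul_mem (zpow_mem hg (-n)) hh)
  · push Not at hell
    exact hT.hasAdaptedPair_of_elliptic_hyperbolic hfree hgen hx hell

end IsAcylindricalAction

/-! ### The Bass–Serre tree of an amalgam -/

namespace Monoid.PushoutI

variable {H : Type*} [Group H]

section LastIndex

variable {ι : Type*} {K : ι → Type*} [∀ i, Group (K i)] {φ : ∀ i, H →* K i}
  {d : NormalWord.Transversal φ}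

/-- The index of the last letter of a normal word, if any. -/
def NormalWord.lastIdx (w : NormalWord d) : Option ι :=
  w.toList.getLast?.map Sigma.fst

theorem NormalWord.prod_mem_range_base {w : NormalWord d} (hw : w.lastIdx = none) :
    w.prod ∈ (base φ).range := by
  refine ⟨w.head, ?_⟩
  have : w.toList = [] := by simpa [NormalWord.lastIdx] using hw
  simp [NormalWord.prod, CoprodI.Word.prod, this]

variable [DecidableEq ι] [∀ i, DecidableEq (K i)]

theorem NormalWord.lastIdx_equivPair_symm (i : ι) (p : NormalWord.Pair d i) :
    ((NormalWord.equivPair i).symm p).lastIdx.getD i =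
      (p.tail.toList.getLast?.map Sigma.fst).getD i := by
  change ((CoprodI.Word.rcons _).toList.getLast?.map Sigma.fst).getD i = _
  rw [CoprodI.Word.rcons]
  split_ifs
  · rfl
  · simp only [CoprodI.Word.cons, List.getLast?_cons, Option.map_some, Option.getD_some]
    cases p.tail.toList.getLast? <;> rfl

theorem NormalWord.lastIdx_of_smul (i : ι) (a : K i) (w : NormalWord d) :
    (of (φ := φ) i a • w).lastIdx.getD i = w.lastIdx.getD i := by
  rw [NormalWord.summand_smul_def, NormalWord.lastIdx_equivPair_symm]
  conv_rhs => rw [← (NormalWord.equivPair i).symm_apply_apply w, NormalWord.lastIdx_equivPair_symm]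

end LastIndex

variable {K : Bool → Type*} [∀ b, Group (K b)] (φ : ∀ b, H →* K b)

/-- A partition of the cosets of the factors into the two sides of the base edge. -/
theorem exists_side (hφ : ∀ b, Function.Injective (φ b)) :
    ∃ side : PushoutI φ → Bool → Bool, (∀ b, side 1 b = b) ∧
      (∀ (g : PushoutI φ) (b : Bool) (a : K b), side (g * of b a) b = side g b) ∧
      ∀ (g : PushoutI φ) (b b' : Bool), g ∉ (base φ).range → side g b = side g b' := by
  classical
  obtain ⟨d⟩ := NormalWord.transversal_nonempty φ hφ
  refine ⟨fun g b ↦ (g⁻¹ • (NormalWord.empty : NormalWord d)).lastIdx.getD b, fun b ↦ ?_,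
    fun g b a ↦ ?_, fun g b b' hg ↦ ?_⟩
  · simp [NormalWord.lastIdx, NormalWord.empty, CoprodI.Word.empty]
  · dsimp only
    rw [mul_inv_rev, mul_smul, ← map_inv, NormalWord.lastIdx_of_smul]
  · cases hw : (g⁻¹ • (NormalWord.empty : NormalWord d)).lastIdx with
    | none =>
      have := NormalWord.prod_mem_range_base hw
      rw [NormalWord.prod_smul, NormalWord.prod_empty, mul_one, inv_mem_iff] at this
      exact absurd this hg
    | some j => simp only [hw, Option.getD_some]

/-- The vertices of the Bass–Serre tree are the cosets of the factors. -/
abbrev BassSerreVertex : Type _ :=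
  Σ b : Bool, PushoutI φ ⧸ (of (φ := φ) b).range

variable {φ}

/-- The vertex given by the coset of `k` in the factor of index `b`. -/
def bassSerreVertex (k : PushoutI φ) (b : Bool) : BassSerreVertex φ :=
  ⟨b, (k : PushoutI φ ⧸ (of (φ := φ) b).range)⟩

theorem exists_eq_bassSerreVertex (x : BassSerreVertex φ) : ∃ k b, x = bassSerreVertex k b := by
  obtain ⟨b, q⟩ := x
  obtain ⟨k, rfl⟩ := QuotientGroup.mk_surjective q
  exact ⟨k, b, rfl⟩

theorem smul_bassSerreVertex (g k : PushoutI φ) (b : Bool) :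
    g • bassSerreVertex k b = bassSerreVertex (g * k) b :=
  rfl

theorem bassSerreVertex_eq_iff {k m : PushoutI φ} {b : Bool} :
    bassSerreVertex k b = bassSerreVertex m b ↔ k⁻¹ * m ∈ (of (φ := φ) b).range := by
  rw [← QuotientGroup.eq]
  exact sigma_mk_injective.eq_iff

theorem mem_stabilizer_bassSerreVertex {g k : PushoutI φ} {b : Bool} :
    g ∈ MulAction.stabilizer (PushoutI φ) (bassSerreVertex k b) ↔
      k⁻¹ * g * k ∈ (of (φ := φ) b).range := by
  rw [MulAction.mem_stabilizer_iff, eq_comm, smul_bassSerreVertex, bassSerreVertex_eq_iff,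
    mul_assoc]

variable (φ) in
/-- The Bass–Serre tree: its edges are the pairs of cosets of the same element in both factors. -/
def bassSerreTree : SimpleGraph (BassSerreVertex φ) where
  Adj x y := ∃ k b, x = bassSerreVertex k b ∧ y = bassSerreVertex k !b
  symm := ⟨fun _ _ ⟨k, b, hx, hy⟩ ↦ ⟨k, !b, hy, by rwa [Bool.not_not]⟩⟩
  loopless := ⟨fun _ ⟨_, _, hx, hy⟩ ↦ by
    simpa [bassSerreVertex] using congrArg Sigma.fst (hx.symm.trans hy)⟩

theorem bassSerreTree_adj (k : PushoutI φ) (b : Bool) :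
    (bassSerreTree φ).Adj (bassSerreVertex k b) (bassSerreVertex k !b) :=
  ⟨k, b, rfl, rfl⟩

theorem bassSerreTree_adj_smul (g : PushoutI φ) {x y : BassSerreVertex φ}
    (h : (bassSerreTree φ).Adj x y) : (bassSerreTree φ).Adj (g • x) (g • y) := by
  obtain ⟨k, b, rfl, rfl⟩ := h
  exact bassSerreTree_adj (g * k) b

theorem bassSerreTree_reachable (k : PushoutI φ) (b b' : Bool) :
    (bassSerreTree φ).Reachable (bassSerreVertex k b) (bassSerreVertex k b') := by
  obtain rfl | rfl := Bool.eq_or_eq_not b' b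
  · exact .rfl
  · exact (bassSerreTree_adj k b).reachable

theorem bassSerreTree_connected : (bassSerreTree φ).Connected := by
  have hof : ∀ (i : Bool) (a : K i) (b : Bool),
      (bassSerreTree φ).Reachable (bassSerreVertex 1 b) (bassSerreVertex (of i a) b) := by
    intro i a b
    have : bassSerreVertex (1 : PushoutI φ) i = bassSerreVertex (of i a) i := by
      rw [bassSerreVertex_eq_iff]
      exact ⟨a, by simp⟩
    refine (bassSerreTree_reachable 1 b i).trans ?_
    rw [this]
    exact bassSerreTree_reachable _ i b
  have key : ∀ (k : PushoutI φ) (b : Bool),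
      (bassSerreTree φ).Reachable (bassSerreVertex 1 b) (bassSerreVertex k b) := by
    intro k
    induction k using PushoutI.induction_on with
    | of i a => exact hof i a
    | base c =>
      rw [← of_apply_eq_base φ true]
      exact hof true _
    | mul x y ihx ihy =>
      intro b
      let f : bassSerreTree φ →g bassSerreTree φ := ⟨(x • ·), bassSerreTree_adj_smul x⟩
      have := (ihy b).map f
      simp only [f, RelHom.coeFn_mk, smul_bassSerreVertex, mul_one] at this
      exact (ihx b).trans this
  have : Nonempty (BassSerreVertex φ) := ⟨bassSerreVertex 1 true⟩
  refine ⟨fun x y ↦ ?_⟩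
  obtain ⟨k, b, rfl⟩ := exists_eq_bassSerreVertex x
  obtain ⟨m, b', rfl⟩ := exists_eq_bassSerreVertex y
  exact ((key k _).symm.trans (bassSerreTree_reachable 1 _ _)).trans (key m _)

theorem bassSerreTree_isAcyclic (hφ : ∀ b, Function.Injective (φ b)) :
    (bassSerreTree φ).IsAcyclic := by
  obtain ⟨side, side_one, side_mul, side_eq⟩ := exists_side φ hφ
  rw [SimpleGraph.isAcyclic_iff_forall_adj_isBridge]
  rintro _ _ ⟨k, b, rfl, rfl⟩
  rw [SimpleGraph.isBridge_iff]
  intro hreach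
  let f : BassSerreVertex φ → Bool := fun x ↦ side (k⁻¹ * x.2.out) x.1
  have hf : ∀ m b, f (bassSerreVertex m b) = side (k⁻¹ * m) b := by
    intro m b
    obtain ⟨⟨_, a, rfl⟩, ha⟩ := QuotientGroup.mk_out_eq_mul (of (φ := φ) b).range m
    change side (k⁻¹ * (m : PushoutI φ ⧸ (of (φ := φ) b).range).out) b = _
    rw [ha, ← mul_assoc, side_mul]
  have hadj : ∀ x y, ((bassSerreTree φ).deleteEdges
      {s(bassSerreVertex k b, bassSerreVertex k !b)}).Adj x y → f x = f y := by
    intro x y h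
    rw [SimpleGraph.deleteEdges_adj] at h
    obtain ⟨⟨m, i, rfl, rfl⟩, hne⟩ := h
    rw [hf, hf]
    refine side_eq _ _ _ fun hbase ↦ hne ?_
    have hkm : ∀ j, bassSerreVertex m j = bassSerreVertex k j := by
      intro j
      rw [eq_comm, bassSerreVertex_eq_iff]
      obtain ⟨c, hc⟩ := hbase
      exact ⟨φ j c, by rw [of_apply_eq_base, hc]⟩
    rw [hkm, hkm]
    obtain rfl | rfl := Bool.eq_or_eq_not i b
    · rfl
    · rw [Bool.not_not, Set.mem_singleton_iff, Sym2.eq_swap]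
  have hwalk : ∀ {x y}, ((bassSerreTree φ).deleteEdges
      {s(bassSerreVertex k b, bassSerreVertex k !b)}).Walk x y → f x = f y := by
    intro x y p
    induction p with
    | nil => rfl
    | cons h _ ih => exact (hadj _ _ h).trans ih
  obtain ⟨p⟩ := hreach
  have hfeq := hwalk p
  rw [hf, hf, inv_mul_cancel, side_one, side_one] at hfeq
  simp at hfeq

theorem even_length_iff {x y : BassSerreVertex φ} (p : (bassSerreTree φ).Walk x y) :
    Even p.length ↔ x.1 = y.1 := by
  induction p with
  | nil => simp
  | @cons x z y h p ih =>
    rw [SimpleGraph.Walk.length_cons, Nat.even_add_one, ih]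
    obtain ⟨k, b, rfl, rfl⟩ := h
    cases b <;> cases y.1 <;> simp [bassSerreVertex]

theorem isTreeAction_bassSerreTree (hφ : ∀ b, Function.Injective (φ b)) :
    IsTreeAction (PushoutI φ) (bassSerreTree φ) where
  isTree := ⟨bassSerreTree_connected, bassSerreTree_isAcyclic hφ⟩
  adj_smul g _ _ h := bassSerreTree_adj_smul g h
  even_dist_smul g x := by
    obtain ⟨p, hp⟩ := bassSerreTree_connected.exists_walk_length_eq_dist x (g • x)
    rw [← hp, even_length_iff]
    rfl

theorem mem_base_range_iff (hφ : ∀ b, Function.Injective (φ b)) (b : Bool) {g : PushoutI φ} :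
    g ∈ (base φ).range ↔ g ∈ (of (φ := φ) b).range ∧ g ∈ (of (φ := φ) !b).range := by
  rw [← inf_of_range_eq_base_range hφ (i := b) (j := !b) (by simp), Subgroup.mem_inf]

theorem exists_smul_eq_of_bassSerreTree_adj {v x y : BassSerreVertex φ}
    (hx : (bassSerreTree φ).Adj v x) (hy : (bassSerreTree φ).Adj v y) :
    ∃ a : PushoutI φ, a • v = v ∧ a • x = y := by
  obtain ⟨k, b, rfl, rfl⟩ := hx
  obtain ⟨m, b', hv, rfl⟩ := hy
  obtain rfl : b = b' := congrArg Sigma.fst hv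
  refine ⟨m * k⁻¹, ?_, ?_⟩
  · rw [smul_bassSerreVertex, inv_mul_cancel_right, hv]
  · rw [smul_bassSerreVertex, inv_mul_cancel_right]

theorem isAcylindricalAction_bassSerreTree (hφ : ∀ b, Function.Injective (φ b))
    (hsurj : ∀ b, ¬ Function.Surjective (φ b))
    (htf : ∀ (x : PushoutI φ) (n : ℕ), 1 ≤ n → x ^ n = 1 → x = 1)
    (hacyl : ∀ i, ∀ a ∈ (of (φ := φ) i).range, a ∉ (base φ).range →
      ∀ b ∈ (of (φ := φ) !i).range, b ∉ (base φ).range → ∀ x ∈ (base φ).range,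
        a⁻¹ * x * a ∈ (base φ).range → b⁻¹ * x * b ∈ (base φ).range → x = 1) :
    IsAcylindricalAction (PushoutI φ) (bassSerreTree φ) where
  toIsTreeAction := isTreeAction_bassSerreTree hφ
  exists_smul_eq := exists_smul_eq_of_bassSerreTree_adj
  eq_one {g x y} hx hy hd := by
    have hT := isTreeAction_bassSerreTree hφ
    obtain ⟨z₁, h₁, h₁'⟩ := hT.isTree.exists_between x y (k := 1) (by omega)
    obtain ⟨z₂, h₂, h₂'⟩ := hT.isTree.exists_between z₁ y (k := 1) (by omega)
    obtain ⟨z₃, h₃, h₃'⟩ := hT.isTree.exists_between z₂ y (k := 1) (by omega)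
    have hg₁ := hT.smul_eq_self_of_between hx hy (z := z₁) (by omega)
    have hg₂ := hT.smul_eq_self_of_between hg₁ hy (z := z₂) (by omega)
    have hg₃ := hT.smul_eq_self_of_between hg₂ hy (z := z₃) (by omega)
    have hne : x ≠ z₂ := by rintro rfl; omega
    have hne' : z₁ ≠ z₃ := by rintro rfl; omega
    rw [SimpleGraph.dist_eq_one_iff_adj] at h₁ h₂ h₃
    obtain ⟨p, hp, hpz⟩ := exists_smul_eq_of_bassSerreTree_adj h₂ h₁.symm
    obtain ⟨q, hq, hqz⟩ := exists_smul_eq_of_bassSerreTree_adj h₂.symm h₃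
    obtain ⟨k, b, rfl, rfl⟩ := h₂
    have hbase : ∀ {m : PushoutI φ}, m • bassSerreVertex k b = bassSerreVertex k b →
        m • bassSerreVertex k (!b) = bassSerreVertex k (!b) → k⁻¹ * m * k ∈ (base φ).range := by
      intro m hm hm'
      rw [mem_base_range_iff hφ b]
      exact ⟨mem_stabilizer_bassSerreVertex.1 hm, mem_stabilizer_bassSerreVertex.1 hm'⟩
    have hbase' : ∀ {m : PushoutI φ}, k⁻¹ * m * k ∈ (base φ).range → ∀ b,
        m • bassSerreVertex k b = bassSerreVertex k b := by
      intro m hm b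
      exact mem_stabilizer_bassSerreVertex.2 ((mem_base_range_iff hφ b).1 hm).1
    have hconj : ∀ {m : PushoutI φ}, g • m • bassSerreVertex k b = m • bassSerreVertex k b →
        g • m • bassSerreVertex k (!b) = m • bassSerreVertex k (!b) →
        (k⁻¹ * m * k)⁻¹ * (k⁻¹ * g * k) * (k⁻¹ * m * k) ∈ (base φ).range := by
      intro m hm hm'
      have := hbase (m := m⁻¹ * g * m) (by rw [mul_smul, mul_smul, hm, inv_smul_smul])
        (by rw [mul_smul, mul_smul, hm', inv_smul_smul])
      convert this using 1
      group
    have hone := hacyl b (k⁻¹ * p * k) (mem_stabilizer_bassSerreVertex.1 hp)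
      (fun h ↦ hne (hpz.symm.trans (hbase' h _))) (k⁻¹ * q * k)
      (mem_stabilizer_bassSerreVertex.1 hq) (fun h ↦ hne' ((hbase' h _).symm.trans hqz))
      (k⁻¹ * g * k) (hbase hg₁ hg₂) (hconj (by rw [hp, hg₁]) (by rw [hpz, hx]))
      (hconj (by rw [hqz, hg₃]) (by rw [hq, hg₂]))
    rwa [mul_assoc, inv_mul_eq_one, right_eq_mul] at hone
  exists_smul_ne := by
    intro x
    by_contra! hfix
    obtain ⟨k, b, rfl⟩ := exists_eq_bassSerreVertex x
    refine hsurj (!b) fun y ↦ ?_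
    have hy : of (!b) y ∈ (base φ).range := by
      rw [mem_base_range_iff hφ b]
      refine ⟨?_, y, rfl⟩
      have := mem_stabilizer_bassSerreVertex.1 (hfix (k * of (!b) y * k⁻¹))
      simpa [mul_assoc] using this
    obtain ⟨c, hc⟩ := hy
    refine ⟨c, of_injective hφ _ ?_⟩
    rw [of_apply_eq_base, hc]
  eq_one_of_pow_eq_one := htf

end Monoid.PushoutI

/-- The conclusion is transported by an isomorphism of groups. -/
theorem AmalgamGeneratingPairConclusion.map {G G' : Type*} [Group G] [Group G'] (e : G ≃* G')
    {C X Y : Subgroup G} {C' X' Y' : Subgroup G'} (hC : ∀ x, e x ∈ C' ↔ x ∈ C)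
    (hX : ∀ x, e x ∈ X' ↔ x ∈ X) (hY : ∀ x, e x ∈ Y' ↔ x ∈ Y)
    (h : AmalgamGeneratingPairConclusion C X Y) : AmalgamGeneratingPairConclusion C' X' Y' := by
  obtain ⟨g, h, hgen, hg, ⟨n, hn, hgn, hne⟩, hcases⟩ := h
  refine ⟨e g, e h, ?_, (hX g).2 hg, ⟨n, hn, ?_, ?_⟩, ?_⟩
  · have := congrArg (Subgroup.map e.toMonoidHom) hgen
    rwa [MonoidHom.map_closure, Set.image_pair,
      Subgroup.map_top_of_surjective e.toMonoidHom e.surjective] at this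
  · rwa [← map_pow, hC]
  · rwa [← map_pow, map_ne_one_iff e e.injective]
  · refine hcases.imp (And.imp (hY h).2 (mt (hC h).1)) (Or.imp ?_ ?_)
    · rintro ⟨a, b, ha, ha', hb, hb', rfl, m, hm, hmem⟩
      refine ⟨e a, e b, (hX a).2 ha, mt (hC a).1 ha', (hY b).2 hb, mt (hC b).1 hb', map_mul e a b,
        m, hm, ?_⟩
      rwa [← map_pow, ← map_inv, ← map_mul, ← map_mul, hC]
    · rintro ⟨a, b, ha, hb, rfl, m, hm, hmem, hne'⟩
      refine ⟨e a, e b, (hX a).2 ha, (hY b).2 hb, by simp only [map_mul, map_inv], m, hm, ?_, ?_⟩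
      · rwa [← map_pow, hC]
      · rwa [← map_pow, map_ne_one_iff e e.injective]

namespace Monoid.PushoutI

variable {H : Type*} [Group H] {K : Bool → Type*} [∀ b, Group (K b)] {φ : ∀ b, H →* K b}

theorem exists_conclusion_of_hasAdaptedPair (hφ : ∀ b, Function.Injective (φ b))
    (h : IsAcylindricalAction.HasAdaptedPair (PushoutI φ) (bassSerreTree φ)) :
    ∃ b, AmalgamGeneratingPairConclusion (base φ).range (of (φ := φ) b).range
      (of (φ := φ) !b).range := by
  obtain ⟨_, _, ⟨k, b, rfl, rfl⟩, h⟩ := h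
  have hmem : ∀ (x : PushoutI φ) (b : Bool), MulAut.conj k⁻¹ x ∈ (of (φ := φ) b).range ↔
      x ∈ MulAction.stabilizer (PushoutI φ) (bassSerreVertex k b) := by
    intro x b
    rw [mem_stabilizer_bassSerreVertex, MulAut.conj_apply, inv_inv]
  refine ⟨b, h.map (MulAut.conj k⁻¹) (fun x ↦ ?_) (fun x ↦ hmem x b) (fun x ↦ hmem x !b)⟩
  rw [mem_base_range_iff hφ b, hmem, hmem, Subgroup.mem_inf]

end Monoid.PushoutI

/-- **Generating pairs of 2-acylindrical amalgams.**  Let `G = A *_C B` with `C` nontrivial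
and proper in each factor, such that `G` is torsion-free, the splitting is 2-acylindrical,
and `G` is 2-generated and not free.  Then there is a generating pair `(g, h)` with
(possibly after exchanging `A` and `B`) `g ∈ A`, `gⁿ ∈ C ∖ {1}` for some `n ≥ 1`, and
`h` of one of the three forms described. -/
theorem amalgam_generating_pair
    {C : Type*} {A B : Type u} [Group A] [Group B] [Group C] [Nontrivial C]
    (f : C →* A) (g : C →* B)
    (hf : Function.Injective f) (hg : Function.Injective g)
    (hfp : ¬ Function.Surjective f) (hgp : ¬ Function.Surjective g)
    (htf : ∀ (x : AmalgamatedProduct f g) (n : ℕ), 1 ≤ n → x ^ n = 1 → x = 1)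
    (hacyl : ∀ a ∈ AmalgamatedProduct.inl.range, a ∉ (Monoid.PushoutI.base (boolFamHom f g)).range →
      ∀ b ∈ AmalgamatedProduct.inr.range, b ∉ (Monoid.PushoutI.base (boolFamHom f g)).range →
      ∀ x ∈ (Monoid.PushoutI.base (boolFamHom f g)).range,
        a⁻¹ * x * a ∈ (Monoid.PushoutI.base (boolFamHom f g)).range →
        b⁻¹ * x * b ∈ (Monoid.PushoutI.base (boolFamHom f g)).range → x = 1)
    (h2gen : ∃ x y : AmalgamatedProduct f g, Subgroup.closure {x, y} = ⊤)
    (hnonfree : ¬ IsFreeGroup (AmalgamatedProduct f g)) :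
    AmalgamGeneratingPairConclusion (Monoid.PushoutI.base (boolFamHom f g)).range
      AmalgamatedProduct.inl.range AmalgamatedProduct.inr.range ∨
    AmalgamGeneratingPairConclusion (Monoid.PushoutI.base (boolFamHom f g)).range
      AmalgamatedProduct.inr.range AmalgamatedProduct.inl.range := by
  have hφ : ∀ b, Function.Injective (boolFamHom f g b)
    | true => hf
    | false => hg
  have hsurj : ∀ b, ¬ Function.Surjective (boolFamHom f g b)
    | true => hfp
    | false => hgp
  have hT := Monoid.PushoutI.isAcylindricalAction_bassSerreTree hφ hsurj htf fun
    | true => hacyl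
    | false => fun b hb hb' a ha ha' x hx hbx hax ↦ hacyl a ha ha' b hb hb' x hx hax hbx
  obtain ⟨_ | _, h⟩ := Monoid.PushoutI.exists_conclusion_of_hasAdaptedPair hφ
    (hT.hasAdaptedPair hnonfree h2gen)
  · exact Or.inr h
  · exact Or.inl h
end
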